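/- arXiv:2603.27901 — 3 statements merged into one kernel-verified Lean document; each statement's English description precedes it below -/
import Mathlib

section
/- Profile Theorem. Let {u_i}_{i∈ℕ} be a uniformly computable family of block-density profiles (each u_i : ℕ → ℚ with 1 < u_i(k) < 2 for all k), and let D ⊆ ℕ × ℕ be a computable (decidable) set of ordered pairs. Assume that, uniformly computably in (i,j) ∈ D, we are given a rational δ_{i,j} > 0 and a strictly increasing computable function s_{i,j} : ℕ → ℕ (with infinite range S_{i,j}) such that u_i(k) ≥ u_j(k) + δ_{i,j} for every k ∈ S_{i,j}. Then there exist a set A ⊆ ℕ that is limit computable, and a uniformly computable family of total surjective functions h_i : ℕ → ℕ (i ∈ ℕ), such that, with a_0 = 0, a_{k+1} = a_k + k!, I_k = [a_k, a_{k+1}): (a) A is constant on each block I_k; (b) each h_i has every fiber h_i⁻¹(y) of size at most 2; (c) setting C_i = {x ∈ ℕ : h_i(x) ∈ A}, one has C_i ≡_bfo A for every i; (d) if u_i(k) ≤ u_j(k) for every k ∈ ℕ, then C_i ≤₁ C_j; (e) if (i,j) ∈ D, then ¬(C_i ≤₁ C_j). In particular, whenever u_i(k) ≤ u_j(k) for all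 k and (j,i) ∈ D, one has C_i <₁ C_j. -/
open Encodable Denumerable

theorem comp_find {α : Type*} [Primcodable α] (P : α → ℕ → Bool) (hP : Computable₂ P)
    (h : ∀ a, ∃ n, P a n = true) : Computable (fun a => Nat.find (h a)) := by
  have h1 : Partrec (fun a => Nat.rfind (fun n => (Part.some (P a n)))) :=
    Partrec.rfind hP.partrec₂
  refine Partrec.of_eq h1 (fun a => ?_)
  rw [PFun.coe_val, Part.eq_some_iff]
  refine Nat.mem_rfind.2 ⟨by simpa using (Nat.find_spec (h a)).symm, ?_⟩
  intro m hm
  have := Nat.find_min (h a) hm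
  simpa using this

def ratOldCode (q : ℚ) : ℕ := Nat.pair (encode q.num) q.den

theorem ratOldCode_strictMono : StrictMono (fun n => ratOldCode (ofNat ℚ n)) := by
  letI := @decidableRangeEncode ℚ Rat.instEncodable
  letI : Infinite (Set.range (@encode ℚ Rat.instEncodable)) :=
    Infinite.of_injective _ (Equiv.ofInjective _ (@encode_injective ℚ Rat.instEncodable)).injective
  have h (n : ℕ) : ratOldCode (ofNat ℚ n) =
      (Nat.Subtype.ofNat (Set.range (@encode ℚ Rat.instEncodable)) n).1 := by
    have := Equiv.apply_symm_apply (@equivRangeEncode ℚ Rat.instEncodable)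
      (Nat.Subtype.ofNat (Set.range (@encode ℚ Rat.instEncodable)) n)
    exact congrArg Subtype.val this
  apply strictMono_nat_of_lt_succ
  intro n
  simp only [h]
  exact Nat.Subtype.lt_succ_self _

def ratCodeP (y : ℕ) : Prop := 0 < y.unpair.2 ∧
  ∀ x < y.unpair.2 + 1, ((y.unpair.1 + 1) / 2 % x = 0 ∧ y.unpair.2 % x = 0) → x = 1

theorem encode_int_half (z : ℤ) : (encode z + 1) / 2 = z.natAbs := by
  cases z with
  | ofNat n => show (2 * n + 1) / 2 = n; omega
  | negSucc n => show (2 * n + 1 + 1) / 2 = n + 1; omega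

theorem ratCodeP_iff (y : ℕ) : ratCodeP y ↔ ∃ q, ratOldCode q = y := by
  obtain ⟨⟨a, d⟩, rfl⟩ := Nat.pairEquiv.surjective y
  have ha : a = encode (ofNat ℤ a) := (encode_ofNat a).symm
  generalize ofNat ℤ a = z at ha
  subst ha
  simp only [ratCodeP, Nat.pairEquiv_apply, Function.uncurry, Nat.unpair_pair, encode_int_half]
  constructor
  · rintro ⟨hd, h⟩
    have hc : z.natAbs.Coprime d := by
      apply h
      · exact Nat.lt_succ_of_le (Nat.gcd_le_right _ hd)
      · exact ⟨Nat.mod_eq_zero_of_dvd (Nat.gcd_dvd_left _ _),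
          Nat.mod_eq_zero_of_dvd (Nat.gcd_dvd_right _ _)⟩
    exact ⟨⟨z, d, hd.ne', hc⟩, rfl⟩
  · rintro ⟨q, hq⟩
    rw [ratOldCode, Nat.pair_eq_pair] at hq
    obtain ⟨h1, h2⟩ := hq
    have h1 := encode_injective h1
    subst h1 h2
    refine ⟨q.den_pos, fun x _ hx => ?_⟩
    have := Nat.dvd_gcd (Nat.dvd_of_mod_eq_zero hx.1) (Nat.dvd_of_mod_eq_zero hx.2)
    rw [q.reduced] at this
    exact Nat.dvd_one.1 this

theorem ratCodeP_primrec : PrimrecPred ratCodeP := by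
  unfold ratCodeP
  have h2 : Primrec (fun y : ℕ => y.unpair.2) := Primrec.snd.comp Primrec.unpair
  have h1 : Primrec (fun y : ℕ => y.unpair.1) := Primrec.fst.comp Primrec.unpair
  have hR : PrimrecRel (fun x y : ℕ =>
      ((y.unpair.1 + 1) / 2 % x = 0 ∧ y.unpair.2 % x = 0) → x = 1) := by
    have e1 : PrimrecPred (fun p : ℕ × ℕ => (p.2.unpair.1 + 1) / 2 % p.1 = 0) :=
      Primrec.eq.comp (Primrec.nat_mod.comp (Primrec.nat_div.comp
        (Primrec.succ.comp (h1.comp Primrec.snd)) (Primrec.const 2)) Primrec.fst) (Primrec.const 0)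
    have e2 : PrimrecPred (fun p : ℕ × ℕ => p.2.unpair.2 % p.1 = 0) :=
      Primrec.eq.comp (Primrec.nat_mod.comp (h2.comp Primrec.snd) Primrec.fst) (Primrec.const 0)
    have e3 : PrimrecPred (fun p : ℕ × ℕ => p.1 = 1) :=
      Primrec.eq.comp Primrec.fst (Primrec.const 1)
    refine PrimrecPred.of_eq ((e1.and e2).not.or e3) (fun p => ?_)
    tauto
  exact (Primrec.nat_lt.comp (Primrec.const 0) h2).and
    (hR.forall_lt.comp (Primrec.succ.comp h2) Primrec.id)

theorem ratOldCode_computable : Computable ratOldCode := by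
  classical
  let P : ℕ → ℕ → Bool := fun x y => decide (x < y ∧ ratCodeP y)
  have hP : Computable₂ P := by
    have : PrimrecPred (fun p : ℕ × ℕ => p.1 < p.2 ∧ ratCodeP p.2) :=
      Primrec.nat_lt.and (ratCodeP_primrec.comp Primrec.snd)
    exact this.decide.to_comp
  have hmono := ratOldCode_strictMono
  have hex : ∀ x, ∃ y, P x y = true := by
    intro x
    refine ⟨ratOldCode (ofNat ℚ (x+1)), ?_⟩
    simp only [P, decide_eq_true_eq]
    exact ⟨lt_of_lt_of_le (Nat.lt_succ_self x) (hmono.le_apply (x := x + 1)),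
      (ratCodeP_iff _).2 ⟨_, rfl⟩⟩
  have hn := comp_find P hP hex
  have hr : Computable (fun n : ℕ => ratOldCode (ofNat ℚ n)) := by
    refine Computable.of_eq (Computable.nat_rec (f := fun n : ℕ => n)
      (g := fun _ => ratOldCode (ofNat ℚ 0))
      (h := fun _ p => Nat.find (hex p.2)) Computable.id (Computable.const _)
      (hn.comp (Computable.snd.comp Computable.snd)).to₂) ?_
    intro n
    induction n with
    | zero => rfl
    | succ n ih =>
      simp only at ih ⊢
      rw [ih]
      rw [Nat.find_eq_iff]
      simp only [P, decide_eq_true_eq]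
      refine ⟨⟨hmono n.lt_succ_self, (ratCodeP_iff _).2 ⟨_, rfl⟩⟩, ?_⟩
      rintro m hm ⟨h1, h2⟩
      obtain ⟨q, rfl⟩ := (ratCodeP_iff _).1 h2
      rw [← ofNat_encode q] at h1 hm
      have a := hmono.lt_iff_lt.1 h1
      have b := hmono.lt_iff_lt.1 hm
      omega
  refine (hr.comp Computable.encode).of_eq (fun q => ?_)
  rw [ofNat_encode]

theorem rat_natAbs_computable : Computable (fun q : ℚ => q.num.natAbs) := by
  have h1 : Primrec (fun y : ℕ => (y.unpair.1 + 1) / 2) :=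
    Primrec.nat_div.comp (Primrec.succ.comp (Primrec.fst.comp Primrec.unpair)) (Primrec.const 2)
  refine (h1.to_comp.comp ratOldCode_computable).of_eq (fun q => ?_)
  simp [ratOldCode, encode_int_half]

theorem rat_den_computable : Computable (fun q : ℚ => q.den) := by
  have h1 : Primrec (fun y : ℕ => y.unpair.2) := Primrec.snd.comp Primrec.unpair
  refine (h1.to_comp.comp ratOldCode_computable).of_eq (fun q => ?_)
  simp [ratOldCode]

open Nat.Partrec (Code)

def dV (b r w : ℕ) : Option ℕ :=
  (Code.evaln w.unpair.1 (ofNat Code r) w.unpair.2).bind fun v =>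
    if b ≤ v.unpair.1 ∧ v.unpair.1 < v.unpair.2 then some v else none

def dSearch (b r : ℕ) (n : ℕ) : Option ℕ :=
  Nat.rec none (fun m ih => ih <|> dV b r m) n

def dBnd (s : ℕ) (r : ℕ) : ℕ :=
  Nat.rec 0 (fun r b => ((dSearch b r s).map (fun v => v.unpair.2 + 1)).getD (b + 1)) r

def dPick (s r : ℕ) : Option ℕ := dSearch (dBnd s r) r s

def dGP (s k : ℕ) : Prop := ∃ r < k + 1, (dPick s r).map (fun v => v.unpair.1) = some k

theorem dV_primrec : Primrec (fun p : (ℕ × ℕ) × ℕ => dV p.1.1 p.1.2 p.2) := by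
  have h1 : Primrec (fun p : (ℕ × ℕ) × ℕ =>
      Code.evaln p.2.unpair.1 (ofNat Code p.1.2) p.2.unpair.2) :=
    Code.primrec_evaln.comp (((Primrec.fst.comp (Primrec.unpair.comp Primrec.snd)).pair
      ((Primrec.ofNat Code).comp (Primrec.snd.comp Primrec.fst))).pair
      (Primrec.snd.comp (Primrec.unpair.comp Primrec.snd)))
  refine Primrec.option_bind h1 ?_
  have hv : Primrec (fun p : ((ℕ × ℕ) × ℕ) × ℕ => p.2.unpair) := Primrec.unpair.comp Primrec.snd
  have hb : Primrec (fun p : ((ℕ × ℕ) × ℕ) × ℕ => p.1.1.1) :=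
    Primrec.fst.comp (Primrec.fst.comp Primrec.fst)
  exact Primrec.ite ((Primrec.nat_le.comp hb (Primrec.fst.comp hv)).and
    (Primrec.nat_lt.comp (Primrec.fst.comp hv) (Primrec.snd.comp hv)))
    (Primrec.option_some.comp Primrec.snd) (Primrec.const none)

theorem dSearch_primrec : Primrec (fun p : (ℕ × ℕ) × ℕ => dSearch p.1.1 p.1.2 p.2) := by
  refine Primrec.nat_rec (α := ℕ × ℕ) (f := fun _ => (none : Option ℕ))
    (g := fun a p => p.2 <|> dV a.1 a.2 p.1) (Primrec.const none) ?_
  exact Primrec.option_orElse.comp (Primrec.snd.comp Primrec.snd)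
    (dV_primrec.comp (Primrec.fst.pair (Primrec.fst.comp Primrec.snd)))

theorem dBnd_primrec : Primrec₂ dBnd := by
  refine Primrec.nat_rec (α := ℕ) (f := fun _ => 0)
    (g := fun s p => ((dSearch p.2 p.1 s).map (fun v => v.unpair.2 + 1)).getD (p.2 + 1))
    (Primrec.const 0) ?_
  have h1 : Primrec (fun q : ℕ × ℕ × ℕ => dSearch q.2.2 q.2.1 q.1) :=
    dSearch_primrec.comp (((Primrec.snd.comp Primrec.snd).pair
      (Primrec.fst.comp Primrec.snd)).pair Primrec.fst)
  have h2 : Primrec (fun v : ℕ => v.unpair.2 + 1) :=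
    Primrec.succ.comp (Primrec.snd.comp Primrec.unpair)
  exact Primrec.option_getD.comp (Primrec.option_map h1 (h2.comp Primrec.snd).to₂)
    (Primrec.succ.comp (Primrec.snd.comp Primrec.snd))

theorem dPick_primrec : Primrec₂ dPick :=
  (dSearch_primrec.comp (((dBnd_primrec.comp Primrec.fst Primrec.snd).pair Primrec.snd).pair
    Primrec.fst)).to₂

theorem dGP_primrec : PrimrecRel dGP := by
  have h1 : Primrec (fun v : ℕ => v.unpair.1) := Primrec.fst.comp Primrec.unpair
  have hR : PrimrecRel (fun (r : ℕ) (y : ℕ × ℕ) =>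
      (dPick y.1 r).map (fun v => v.unpair.1) = some y.2) :=
    Primrec.eq.comp (Primrec.option_map (dPick_primrec.comp (Primrec.fst.comp Primrec.snd)
      Primrec.fst) (h1.comp Primrec.snd).to₂)
      (Primrec.option_some.comp (Primrec.snd.comp Primrec.snd))
  have h2 : PrimrecPred (fun a : ℕ × ℕ => ∃ r ∈ List.range (a.2 + 1),
      (dPick a.1 r).map (fun v => v.unpair.1) = some a.2) :=
    hR.exists_mem_list.comp (Primrec.list_range.comp (Primrec.succ.comp Primrec.snd)) Primrec.id
  exact h2.of_eq (fun a => by simp only [dGP, List.mem_range])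

theorem dV_spec {b r w v : ℕ} (h : dV b r w = some v) :
    b ≤ v.unpair.1 ∧ v.unpair.1 < v.unpair.2 ∧
      ∃ x, v ∈ (ofNat Code r).eval x := by
  unfold dV at h
  rw [Option.bind_eq_some_iff] at h
  obtain ⟨v', h1, h2⟩ := h
  split_ifs at h2 with hc
  obtain rfl : v' = v := by simpa using h2
  exact ⟨hc.1, hc.2, _, Code.evaln_sound h1⟩

theorem dSearch_succ (b r n : ℕ) : dSearch b r (n + 1) = (dSearch b r n <|> dV b r n) := rfl

theorem dSearch_spec {b r n v : ℕ} (h : dSearch b r n = some v) : ∃ w, dV b r w = some v := by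
  induction n with
  | zero => exact absurd h (by simp [dSearch])
  | succ n ih =>
    rw [dSearch_succ] at h
    cases hs : dSearch b r n with
    | none => rw [hs] at h; exact ⟨n, by simpa using h⟩
    | some v' => rw [hs] at h; exact ih (by rw [hs]; simpa using h)

theorem dSearch_mono {b r n m v : ℕ} (h : dSearch b r n = some v) (hm : n ≤ m) :
    dSearch b r m = some v := by
  induction m, hm using Nat.le_induction with
  | base => exact h
  | succ m _ ih => rw [dSearch_succ, ih]; rfl

theorem dSearch_lim (b r : ℕ) : ∃ o s₀, ∀ s, s₀ ≤ s → dSearch b r s = o := by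
  by_cases h : ∃ s v, dSearch b r s = some v
  · obtain ⟨s, v, h⟩ := h
    exact ⟨some v, s, fun t ht => dSearch_mono h ht⟩
  · refine ⟨none, 0, fun s _ => ?_⟩
    cases hs : dSearch b r s with
    | none => rfl
    | some v => exact absurd ⟨s, v, hs⟩ h

theorem dBnd_succ (s r : ℕ) : dBnd s (r + 1) =
    ((dPick s r).map (fun v => v.unpair.2 + 1)).getD (dBnd s r + 1) := rfl

theorem dBnd_lim (r : ℕ) : ∃ b s₀, ∀ s, s₀ ≤ s → dBnd s r = b := by
  induction r with
  | zero => exact ⟨0, 0, fun _ _ => rfl⟩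
  | succ r ih =>
    obtain ⟨b, s₀, h⟩ := ih
    obtain ⟨o, s₁, h1⟩ := dSearch_lim b r
    refine ⟨(o.map (fun v => v.unpair.2 + 1)).getD (b + 1), max s₀ s₁, fun s hs => ?_⟩
    have e := h s (le_trans (le_max_left _ _) hs)
    rw [dBnd_succ, dPick, e, h1 s (le_trans (le_max_right _ _) hs)]

theorem dPick_lim (r : ℕ) : ∃ o s₀, ∀ s, s₀ ≤ s → dPick s r = o := by
  obtain ⟨b, s₀, h⟩ := dBnd_lim r
  obtain ⟨o, s₁, h1⟩ := dSearch_lim b r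
  refine ⟨o, max s₀ s₁, fun s hs => ?_⟩
  rw [dPick, h s (le_trans (le_max_left _ _) hs), h1 s (le_trans (le_max_right _ _) hs)]

theorem dPick_lim_le (k : ℕ) : ∃ s₀, ∀ r < k, ∀ s, s₀ ≤ s → dPick s r = dPick s₀ r := by
  induction k with
  | zero => exact ⟨0, fun r hr => absurd hr (Nat.not_lt_zero _)⟩
  | succ k ih =>
    obtain ⟨s₀, h⟩ := ih
    obtain ⟨o, s₁, h1⟩ := dPick_lim k
    refine ⟨max s₀ s₁, fun r hr s hs => ?_⟩
    have a0 : s₀ ≤ s := le_trans (le_max_left _ _) hs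
    have a1 : s₁ ≤ s := le_trans (le_max_right _ _) hs
    rcases Nat.lt_succ_iff_lt_or_eq.1 hr with hr | rfl
    · rw [h r hr s a0, h r hr _ (le_max_left _ _)]
    · rw [h1 s a1, h1 _ (le_max_right _ _)]

theorem dPick_spec {s r v : ℕ} (h : dPick s r = some v) :
    dBnd s r ≤ v.unpair.1 ∧ v.unpair.1 < v.unpair.2 ∧ dBnd s (r + 1) = v.unpair.2 + 1 ∧
      ∃ x, v ∈ (ofNat Code r).eval x := by
  obtain ⟨w, hw⟩ := dSearch_spec h
  obtain ⟨h1, h2, h3⟩ := dV_spec hw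
  refine ⟨h1, h2, ?_, h3⟩
  rw [dBnd_succ, h]; rfl

theorem dBnd_lt_succ (s r : ℕ) : dBnd s r < dBnd s (r + 1) := by
  cases h : dPick s r with
  | none => rw [dBnd_succ, h]; simp
  | some v =>
    obtain ⟨h1, h2, h3, -⟩ := dPick_spec h
    omega

theorem dBnd_strictMono (s : ℕ) : StrictMono (dBnd s) := strictMono_nat_of_lt_succ (dBnd_lt_succ s)

theorem diag_exists : ∃ (B : Set ℕ) (g : ℕ → ℕ → Bool), Computable₂ g ∧
    (∀ n, ∃ s₀, ∀ s, s₀ ≤ s → (g s n = true ↔ n ∈ B)) ∧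
    ∀ p q : ℕ → ℕ, Computable p → Computable q → (∀ b, ∃ x, b ≤ p x ∧ p x < q x) →
      ∃ x, p x ∈ B ∧ q x ∉ B := by
  classical
  have hlim : ∀ k, ∃ s₀, ∀ s, s₀ ≤ s → (dGP s k ↔ dGP s₀ k) := by
    intro k
    obtain ⟨s₀, h⟩ := dPick_lim_le (k + 1)
    refine ⟨s₀, fun s hs => ?_⟩
    unfold dGP
    constructor
    · rintro ⟨r, hr, e⟩; exact ⟨r, hr, by rw [← h r hr s hs]; exact e⟩
    · rintro ⟨r, hr, e⟩; exact ⟨r, hr, by rw [h r hr s hs]; exact e⟩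
  choose L hL using hlim
  refine ⟨{k | dGP (L k) k}, fun s k => decide (dGP s k), dGP_primrec.decide.to_comp,
    fun n => ⟨L n, fun s hs => by simpa using hL n s hs⟩, ?_⟩
  intro p q hp hq hpq
  have hc : Computable (fun x => Nat.pair (p x) (q x)) :=
    Primrec₂.natPair.to_comp.comp hp hq
  obtain ⟨c, hc⟩ := Code.exists_code.1 (Partrec.nat_iff.1 hc)
  set e := encode c with he
  have hce : ofNat Code e = c := ofNat_encode c
  obtain ⟨b, s₀, hb⟩ := dBnd_lim e
  obtain ⟨x, hx1, hx2⟩ := hpq b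
  have hev : Nat.pair (p x) (q x) ∈ c.eval x := by rw [hc]; simp
  obtain ⟨t, ht⟩ := Code.evaln_complete.1 hev
  have hV : dV b e (Nat.pair t x) = some (Nat.pair (p x) (q x)) := by
    unfold dV
    rw [hce]
    simp only [Nat.unpair_pair]
    rw [Option.mem_def.1 ht]
    simp [hx1, hx2]
  obtain ⟨v, hv⟩ : ∃ v, dSearch b e (Nat.pair t x + 1) = some v := by
    rw [dSearch_succ, hV]
    cases dSearch b e (Nat.pair t x) with
    | none => exact ⟨_, rfl⟩
    | some v => exact ⟨v, rfl⟩
  let s := max (max s₀ (Nat.pair t x + 1)) (max (L v.unpair.1) (L v.unpair.2))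
  have hs0 : s₀ ≤ s := le_trans (le_max_left _ _) (le_max_left _ _)
  have hs1 : Nat.pair t x + 1 ≤ s := le_trans (le_max_right _ _) (le_max_left _ _)
  have hs2 : L v.unpair.1 ≤ s := le_trans (le_max_left _ _) (le_max_right _ _)
  have hs3 : L v.unpair.2 ≤ s := le_trans (le_max_right _ _) (le_max_right _ _)
  have hpick : dPick s e = some v := by
    rw [dPick, hb s hs0]; exact dSearch_mono hv hs1
  obtain ⟨h1, h2, h3, y, hy⟩ := dPick_spec hpick
  rw [hce, hc] at hy
  have hvy : v = Nat.pair (p y) (q y) := by simpa using hy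
  have hp1 : p y = v.unpair.1 := by simp [hvy]
  have hq1 : q y = v.unpair.2 := by simp [hvy]
  refine ⟨y, ?_, ?_⟩
  · rw [hp1]
    refine (hL _ s hs2).1 ⟨e, ?_, by rw [hpick]; rfl⟩
    have := (dBnd_strictMono s).le_apply (x := e)
    omega
  · rw [hq1]
    intro hmem
    obtain ⟨r, hr, h⟩ := (hL _ s hs3).2 hmem
    rw [Option.map_eq_some_iff] at h
    obtain ⟨v', hv', h⟩ := h
    obtain ⟨g1, g2, g3, -⟩ := dPick_spec hv'
    rcases lt_trichotomy r e with hre | rfl | hre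
    · have := (dBnd_strictMono s).monotone (Nat.succ_le_of_lt hre)
      simp only [Nat.succ_eq_add_one] at this
      omega
    · rw [hpick] at hv'
      obtain rfl : v = v' := by simpa using hv'
      omega
    · have := (dBnd_strictMono s).monotone (Nat.succ_le_of_lt hre)
      simp only [Nat.succ_eq_add_one] at this
      omega

def cum (n : ℕ → ℕ) (k : ℕ) : ℕ := ∑ m ∈ Finset.range k, n m

def idx (n : ℕ → ℕ) (x : ℕ) : ℕ :=
  Nat.rec 0 (fun x i => if x + 1 < cum n (i + 1) then i else i + 1) x

theorem cum_succ (n : ℕ → ℕ) (k : ℕ) : cum n (k + 1) = cum n k + n k := Finset.sum_range_succ _ _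

theorem cum_mono (n : ℕ → ℕ) : Monotone (cum n) :=
  monotone_nat_of_le_succ (fun k => by rw [cum_succ]; omega)

theorem idx_spec {n : ℕ → ℕ} (hn : ∀ k, 1 ≤ n k) (x : ℕ) :
    cum n (idx n x) ≤ x ∧ x < cum n (idx n x + 1) := by
  induction x with
  | zero =>
    have h0 : idx n 0 = 0 := rfl
    have := hn 0
    have c0 : cum n 0 = 0 := rfl
    rw [h0, cum_succ]; omega
  | succ x ih =>
    have h0 : idx n (x + 1) =
      if x + 1 < cum n (idx n x + 1) then idx n x else idx n x + 1 := rfl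
    rw [h0]
    split_ifs with hc
    · omega
    · have h1 := cum_succ n (idx n x + 1)
      have := hn (idx n x + 1)
      omega

theorem idx_unique {n : ℕ → ℕ} (hn : ∀ k, 1 ≤ n k) {x k : ℕ} (h1 : cum n k ≤ x)
    (h2 : x < cum n (k + 1)) : idx n x = k := by
  obtain ⟨g1, g2⟩ := idx_spec hn x
  rcases lt_trichotomy (idx n x) k with h | h | h
  · have := cum_mono n (Nat.succ_le_of_lt h)
    simp only [Nat.succ_eq_add_one] at this
    omega
  · exact h
  · have := cum_mono n (Nat.succ_le_of_lt h)
    simp only [Nat.succ_eq_add_one] at this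
    omega

theorem exists_off {n : ℕ → ℕ} (hn : ∀ k, 1 ≤ n k) (x : ℕ) :
    ∃ k o, o < n k ∧ x = cum n k + o := by
  obtain ⟨g1, g2⟩ := idx_spec hn x
  rw [cum_succ] at g2
  exact ⟨idx n x, x - cum n (idx n x), by omega, by omega⟩

theorem idx_add {n : ℕ → ℕ} (hn : ∀ k, 1 ≤ n k) {k o : ℕ} (h : o < n k) :
    idx n (cum n k + o) = k :=
  idx_unique hn (by omega) (by rw [cum_succ]; omega)

def tr (m n : ℕ → ℕ) (x : ℕ) : ℕ := cum n (idx m x) + (x - cum m (idx m x))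

def hm (n : ℕ → ℕ) (x : ℕ) : ℕ :=
  cum Nat.factorial (idx n x) + (x - cum n (idx n x)) % (idx n x).factorial

theorem tr_add {m n : ℕ → ℕ} (hm : ∀ k, 1 ≤ m k) {k o : ℕ} (h : o < m k) :
    tr m n (cum m k + o) = cum n k + o := by
  rw [tr, idx_add hm h, Nat.add_sub_cancel_left]

theorem hm_add {n : ℕ → ℕ} (hn : ∀ k, 1 ≤ n k) {k o : ℕ} (h : o < n k) :
    hm n (cum n k + o) = cum Nat.factorial k + o % k.factorial := by
  rw [hm, idx_add hn h, Nat.add_sub_cancel_left]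

theorem fact_pos' (k : ℕ) : 1 ≤ Nat.factorial k := Nat.factorial_pos k

theorem idx_hm {n : ℕ → ℕ} (hn : ∀ k, 1 ≤ n k) (x : ℕ) : idx Nat.factorial (hm n x) = idx n x := by
  rw [hm]
  exact idx_add fact_pos' (Nat.mod_lt _ (Nat.factorial_pos _))

theorem hm_tr {m n : ℕ → ℕ} (hm1 : ∀ k, 1 ≤ m k) (hmn : ∀ k, m k ≤ n k) (x : ℕ) :
    hm n (tr m n x) = hm m x := by
  obtain ⟨k, o, ho, rfl⟩ := exists_off hm1 x
  rw [tr_add hm1 ho, hm_add hm1 ho,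
    hm_add (fun k => (hm1 k).trans (hmn k)) (ho.trans_le (hmn k))]

theorem hm_fact (x : ℕ) : hm Nat.factorial x = x := by
  obtain ⟨k, o, ho, rfl⟩ := exists_off fact_pos' x
  rw [hm_add fact_pos' ho, Nat.mod_eq_of_lt ho]

theorem tr_inj {m n : ℕ → ℕ} (hm1 : ∀ k, 1 ≤ m k) (hmn : ∀ k, m k ≤ n k) :
    Function.Injective (tr m n) := by
  intro x y hxy
  obtain ⟨k, o, ho, rfl⟩ := exists_off hm1 x
  obtain ⟨k', o', ho', rfl⟩ := exists_off hm1 y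
  rw [tr_add hm1 ho, tr_add hm1 ho'] at hxy
  have hn1 : ∀ k, 1 ≤ n k := fun k => (hm1 k).trans (hmn k)
  have e := congrArg (idx n) hxy
  rw [idx_add hn1 (ho.trans_le (hmn k)), idx_add hn1 (ho'.trans_le (hmn k'))] at e
  subst e
  omega

theorem hm_fiber {n : ℕ → ℕ} (hn : ∀ k, Nat.factorial k ≤ n k)
    (hn2 : ∀ k, n k ≤ 2 * Nat.factorial k) (y : ℕ) : {x | hm n x = y}.encard ≤ 2 := by
  have hn1 : ∀ k, 1 ≤ n k := fun k => (fact_pos' k).trans (hn k)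
  obtain ⟨k, o, ho, rfl⟩ := exists_off fact_pos' y
  refine le_trans (Set.encard_le_encard (t := {cum n k + o, cum n k + (o + k.factorial)}) ?_)
    ((Set.encard_insert_le _ _).trans (by rw [Set.encard_singleton]; norm_num))
  intro x hx
  obtain ⟨k', o', ho', rfl⟩ := exists_off hn1 x
  simp only [Set.mem_ofPred_eq] at hx
  rw [hm_add hn1 ho'] at hx
  have e := congrArg (idx Nat.factorial) hx
  rw [idx_add fact_pos' (Nat.mod_lt _ (Nat.factorial_pos _)), idx_add fact_pos' ho] at e
  subst e
  have h2 := hn2 k'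
  have h3 := Nat.div_add_mod o' k'.factorial
  have h4 : o' / k'.factorial < 2 := by
    rw [Nat.div_lt_iff_lt_mul (Nat.factorial_pos _)]; omega
  have h5 : o' % k'.factorial = o := by omega
  simp only [Set.mem_insert_iff, Set.mem_singleton_iff]
  generalize o' / k'.factorial = d at *
  interval_cases d
  · left; omega
  · right; omega

theorem blockStart_bound (k : ℕ) : cum Nat.factorial (k + 1) ≤ 2 * Nat.factorial k := by
  induction k with
  | zero => decide
  | succ k ih =>
    rw [cum_succ]
    rcases k with _ | k
    · decide
    · have : 2 * Nat.factorial (k + 1) ≤ Nat.factorial (k + 1 + 1) := by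
        rw [Nat.factorial_succ (k + 1)]
        exact Nat.mul_le_mul_right _ (by omega)
      omega

theorem cum_comp {N : ℕ → ℕ → ℕ} (hN : Computable₂ N) : Computable₂ (fun i k => cum (N i) k) := by
  refine Computable.of_eq (Computable.nat_rec (α := ℕ × ℕ) (f := fun p => p.2) (g := fun _ => 0)
    (h := fun a p => p.2 + N a.1 p.1) Computable.snd (Computable.const 0) ?_) ?_
  · exact Primrec.nat_add.to_comp.comp (Computable.snd.comp Computable.snd)
      (hN.comp (Computable.fst.comp Computable.fst) (Computable.fst.comp Computable.snd))
  · rintro ⟨i, k⟩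
    simp only
    induction k with
    | zero => rfl
    | succ k ih => rw [cum_succ, ← ih]

theorem idx_comp {N : ℕ → ℕ → ℕ} (hN : Computable₂ N) : Computable₂ (fun i x => idx (N i) x) := by
  refine Computable.of_eq (Computable.nat_rec (α := ℕ × ℕ) (f := fun p => p.2) (g := fun _ => 0)
    (h := fun a p => bif decide (p.1 + 1 < cum (N a.1) (p.2 + 1)) then p.2 else p.2 + 1)
    Computable.snd (Computable.const 0) ?_) ?_
  · have h2 : Computable (fun q : (ℕ × ℕ) × ℕ × ℕ => q.2.2) := Computable.snd.comp Computable.snd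
    refine Computable.cond ?_ h2 (Computable.succ.comp h2)
    exact Primrec.nat_lt.decide.to_comp.comp
      (Computable.succ.comp (Computable.fst.comp Computable.snd))
      ((cum_comp hN).comp (Computable.fst.comp Computable.fst) (Computable.succ.comp h2))
  · rintro ⟨i, k⟩
    simp only [idx, cond_eq_ite, decide_eq_true_eq]

theorem tr_comp {M N : ℕ → ℕ → ℕ} (hM : Computable₂ M) (hN : Computable₂ N) (i j : ℕ) :
    Computable (tr (M i) (N j)) := by
  have hi : Computable (fun x => idx (M i) x) := (idx_comp hM).comp (Computable.const i) Computable.id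
  exact Primrec.nat_add.to_comp.comp ((cum_comp hN).comp (Computable.const j) hi)
    (Primrec.nat_sub.to_comp.comp Computable.id ((cum_comp hM).comp (Computable.const i) hi))

theorem fact_comp : Computable Nat.factorial := by
  refine Computable.of_eq (Computable.nat_rec (α := ℕ) (f := fun p => p) (g := fun _ => 1)
    (h := fun _ p => (p.1 + 1) * p.2) Computable.id (Computable.const 1) ?_) ?_
  · exact Primrec.nat_mul.to_comp.comp (Computable.succ.comp (Computable.fst.comp Computable.snd))
      (Computable.snd.comp Computable.snd)
  · intro n
    simp only
    induction n with
    | zero => rfl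
    | succ n ih => rw [Nat.factorial_succ, ← ih]

theorem hm_comp {N : ℕ → ℕ → ℕ} (hN : Computable₂ N) : Computable₂ (fun i x => hm (N i) x) := by
  have hi : Computable (fun p : ℕ × ℕ => idx (N p.1) p.2) := idx_comp hN
  have hF : Computable₂ (fun _ k : ℕ => Nat.factorial k) := (fact_comp.comp Computable.snd).to₂
  exact Primrec.nat_add.to_comp.comp ((cum_comp hF).comp (Computable.const 0) hi)
    (Primrec.nat_mod.to_comp.comp (Primrec.nat_sub.to_comp.comp Computable.snd
      ((cum_comp hN).comp Computable.fst hi)) (fact_comp.comp hi))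

def sz (u : ℕ → ℕ → ℚ) (i k : ℕ) : ℕ := (u i k).num.natAbs * k.factorial / (u i k).den

theorem sz_comp {u : ℕ → ℕ → ℚ} (hu : Computable₂ u) : Computable₂ (sz u) :=
  Primrec.nat_div.to_comp.comp (Primrec.nat_mul.to_comp.comp (rat_natAbs_computable.comp hu)
    (fact_comp.comp Computable.snd)) (rat_den_computable.comp hu)

theorem sz_eq {u : ℕ → ℕ → ℚ} {i k : ℕ} (h : 0 < u i k) :
    sz u i k = ⌊u i k * (k.factorial : ℚ)⌋₊ := by
  have hn : ((u i k).num.natAbs : ℚ) = ((u i k).num : ℚ) := by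
    have : 0 < (u i k).num := Rat.num_pos.2 h
    rw [Nat.cast_natAbs, abs_of_pos this]
  have : u i k * (k.factorial : ℚ) =
      (((u i k).num.natAbs * k.factorial : ℕ) : ℚ) / ((u i k).den : ℚ) := by
    push_cast
    rw [hn]
    conv_lhs => rw [← Rat.num_div_den (u i k)]
    ring
  rw [this, Nat.floor_div_eq_div, sz]

theorem cum_le_two {n : ℕ → ℕ} (hn2 : ∀ k, n k ≤ 2 * Nat.factorial k) (k : ℕ) :
    cum n k ≤ 2 * cum Nat.factorial k := by
  rw [cum, cum, Finset.mul_sum]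
  exact Finset.sum_le_sum (fun m _ => hn2 m)

theorem escape {n m : ℕ → ℕ} (hn : ∀ k, 1 ≤ n k) (hm1 : ∀ k, 1 ≤ m k) {f : ℕ → ℕ}
    (hf : Function.Injective f) {k : ℕ} (hk : cum m (k + 1) < n k) :
    ∃ x, idx n x = k ∧ k < idx m (f x) := by
  by_contra hcon
  push Not at hcon
  have hmap : ∀ o ∈ Finset.range (n k), f (cum n k + o) ∈ Finset.range (cum m (k + 1)) := by
    intro o ho
    rw [Finset.mem_range] at ho ⊢
    have h1 := hcon _ (idx_add hn ho)
    have h2 := (idx_spec hm1 (f (cum n k + o))).2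
    exact h2.trans_le (cum_mono m (by omega))
  have := Finset.card_le_card_of_injOn (fun o => f (cum n k + o)) hmap
    (fun a _ b _ hab => by have := hf hab; omega)
  simp only [Finset.card_range] at this
  omega


/-- One-one reducibility: `B ≤₁ C` via a total computable injective function. -/
def OneOneRed (B C : Set ℕ) : Prop :=
  ∃ f : ℕ → ℕ, Computable f ∧ Function.Injective f ∧ ∀ x, x ∈ B ↔ f x ∈ C

/-- Strict one-one reducibility: `B <₁ C`. -/
def OneOneLt (B C : Set ℕ) : Prop :=
  OneOneRed B C ∧ ¬ OneOneRed C B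

/-- Bounded finite-one reducibility: `B ≤_bfo C` via a total computable function
all of whose fibers have size at most some constant `c ≥ 1`. -/
def BfoRed (B C : Set ℕ) : Prop :=
  ∃ f : ℕ → ℕ, Computable f ∧
    (∃ c : ℕ, 1 ≤ c ∧ ∀ y, {x | f x = y}.encard ≤ (c : ℕ∞)) ∧
    ∀ x, x ∈ B ↔ f x ∈ C

/-- Bounded finite-one equivalence: `B ≡_bfo C`. -/
def BfoEquiv (B C : Set ℕ) : Prop :=
  BfoRed B C ∧ BfoRed C B

/-- `A` is limit computable (equivalently `A ≤_T ∅'`, i.e. `Δ⁰₂`). -/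
def LimitComputable (A : Set ℕ) : Prop :=
  ∃ g : ℕ → ℕ → Bool, Computable₂ g ∧
    ∀ n, ∃ s₀, ∀ s, s₀ ≤ s → (g s n = true ↔ n ∈ A)

/-- `a_k`, the left endpoint of the `k`-th block `I_k = [a_k, a_{k+1})`;
`a_0 = 0` and `a_{k+1} = a_k + k!`. -/
def blockStart (k : ℕ) : ℕ := ∑ m ∈ Finset.range k, Nat.factorial m

/-- **Profile Theorem.**  Given a uniformly computable family of block-density
profiles `u_i : ℕ → ℚ` with values in `(1,2)`, a computable set `D` of pairs,
and, uniformly computably for `(i,j) ∈ D`, rationals `δ_{i,j} > 0` and strictly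
increasing computable functions `s_{i,j}` along whose range `u_i ≥ u_j + δ_{i,j}`,
there are a limit computable set `A` and a uniformly computable family of
surjective functions `h_i` such that: (a) `A` is constant on each block `I_k`;
(b) every fiber of every `h_i` has size at most 2; (c) `C_i = h_i⁻¹(A)` is
bounded finite-one equivalent to `A`; (d) pointwise domination of profiles
yields `C_i ≤₁ C_j`; (e) `(i,j) ∈ D` yields `¬ C_i ≤₁ C_j`; and in particular
pointwise domination together with `(j,i) ∈ D` yields `C_i <₁ C_j`. -/
theorem profile_theorem
    (u : ℕ → ℕ → ℚ) (hu_comp : Computable₂ u)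
    (hu_range : ∀ i k, 1 < u i k ∧ u i k < 2)
    (D : ℕ → ℕ → Bool) (hD_comp : Computable₂ D)
    (δ : ℕ → ℕ → ℚ) (hδ_comp : Computable₂ δ)
    (hδ_pos : ∀ i j, D i j = true → 0 < δ i j)
    (s : ℕ → ℕ → ℕ → ℕ)
    (hs_comp : Computable (fun p : ℕ × ℕ × ℕ => s p.1 p.2.1 p.2.2))
    (hs_mono : ∀ i j, D i j = true → StrictMono (s i j))
    (hgap : ∀ i j, D i j = true → ∀ t, u j (s i j t) + δ i j ≤ u i (s i j t)) :
    ∃ (A : Set ℕ) (h : ℕ → ℕ → ℕ),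
      LimitComputable A ∧
      Computable₂ h ∧
      (∀ i, Function.Surjective (h i)) ∧
      -- (a) A is constant on each block I_k = [a_k, a_{k+1})
      (∀ k, ∀ x ∈ Set.Ico (blockStart k) (blockStart (k+1)),
            ∀ y ∈ Set.Ico (blockStart k) (blockStart (k+1)), (x ∈ A ↔ y ∈ A)) ∧
      -- (b) every fiber of h_i has size at most 2
      (∀ i y, {x | h i x = y}.encard ≤ 2) ∧
      -- (c) C_i ≡_bfo A where C_i = {x | h_i x ∈ A}
      (∀ i, BfoEquiv {x | h i x ∈ A} A) ∧
      -- (d) pointwise domination gives a positive 1-reduction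
      (∀ i j, (∀ k, u i k ≤ u j k) →
        OneOneRed {x | h i x ∈ A} {x | h j x ∈ A}) ∧
      -- (e) pairs in D are diagonalized against
      (∀ i j, D i j = true →
        ¬ OneOneRed {x | h i x ∈ A} {x | h j x ∈ A}) ∧
      -- in particular: strict comparisons
      (∀ i j, (∀ k, u i k ≤ u j k) → D j i = true →
        OneOneLt {x | h i x ∈ A} {x | h j x ∈ A}) := by
  have hpos : ∀ i k, 0 < u i k := fun i k => lt_trans one_pos (hu_range i k).1
  have hN : Computable₂ (sz u) := sz_comp hu_comp
  have hF : Computable₂ (fun _ k : ℕ => Nat.factorial k) := (fact_comp.comp Computable.snd).to₂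
  have hlow : ∀ i k, Nat.factorial k ≤ sz u i k := by
    intro i k
    rw [sz_eq (hpos i k)]
    apply Nat.le_floor
    have : (0 : ℚ) < k.factorial := by exact_mod_cast Nat.factorial_pos k
    nlinarith [(hu_range i k).1]
  have hhigh : ∀ i k, sz u i k ≤ 2 * Nat.factorial k := by
    intro i k
    rw [sz_eq (hpos i k)]
    apply Nat.floor_le_of_le
    have : (0 : ℚ) < k.factorial := by exact_mod_cast Nat.factorial_pos k
    push_cast
    nlinarith [(hu_range i k).2]
  have hone : ∀ i k, 1 ≤ sz u i k := fun i k => (fact_pos' k).trans (hlow i k)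
  obtain ⟨B, g, hg, hgB, hdiag⟩ := diag_exists
  have hblk : Computable (fun x => idx Nat.factorial x) :=
    (idx_comp hF).comp (Computable.const 0) Computable.id
  have hd : ∀ i j, (∀ k, u i k ≤ u j k) →
      OneOneRed {x | hm (sz u i) x ∈ {y | idx Nat.factorial y ∈ B}}
        {x | hm (sz u j) x ∈ {y | idx Nat.factorial y ∈ B}} := by
    intro i j hij
    have hle : ∀ k, sz u i k ≤ sz u j k := by
      intro k
      rw [sz_eq (hpos i k), sz_eq (hpos j k)]
      exact Nat.floor_le_floor (mul_le_mul_of_nonneg_right (hij k) (by positivity))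
    refine ⟨tr (sz u i) (sz u j), tr_comp hN hN i j, tr_inj (hone i) hle, fun x => ?_⟩
    simp only [Set.mem_ofPred_eq]
    rw [hm_tr (hone i) hle]
  have he : ∀ i j, D i j = true →
      ¬ OneOneRed {x | hm (sz u i) x ∈ {y | idx Nat.factorial y ∈ B}}
        {x | hm (sz u j) x ∈ {y | idx Nat.factorial y ∈ B}} := by
    rintro i j hD ⟨f, hf, hinj, hred⟩
    have hp : Computable (fun x => idx (sz u i) x) :=
      (idx_comp hN).comp (Computable.const i) Computable.id
    have hq : Computable (fun x => idx (sz u j) (f x)) :=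
      (idx_comp hN).comp (Computable.const j) hf
    obtain ⟨x, hx1, hx2⟩ := hdiag _ _ hp hq (by
      intro b
      obtain ⟨M, hM⟩ := exists_nat_gt (5 / δ i j)
      have hδ := hδ_pos i j hD
      rw [div_lt_iff₀ hδ] at hM
      have hge : M + b + 1 ≤ s i j (M + b + 1) := (hs_mono i j hD).le_apply
      have hgp := hgap i j hD (M + b + 1)
      obtain ⟨m, hm'⟩ : ∃ m, s i j (M + b + 1) = m + 1 :=
        ⟨s i j (M + b + 1) - 1, by omega⟩
      rw [hm'] at hge hgp
      have hk : cum (sz u j) (m + 1 + 1) < sz u i (m + 1) := by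
        rw [cum_succ]
        have c1 := cum_le_two (hhigh j) (m + 1)
        have c2 := blockStart_bound m
        have c3 : cum (sz u j) (m + 1) ≤ 4 * m.factorial := by omega
        have c3' : (cum (sz u j) (m + 1) : ℚ) ≤ 4 * (m.factorial : ℚ) := by exact_mod_cast c3
        have c4 : (sz u j (m + 1) : ℚ) ≤ u j (m + 1) * ((m + 1).factorial : ℚ) := by
          rw [sz_eq (hpos j _)]
          exact Nat.floor_le (mul_nonneg (hpos j _).le (by positivity))
        have c5 : u i (m + 1) * ((m + 1).factorial : ℚ) < sz u i (m + 1) + 1 := by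
          rw [sz_eq (hpos i _)]
          exact Nat.lt_floor_add_one _
        have c6 : (1 : ℚ) ≤ m.factorial := by exact_mod_cast Nat.factorial_pos m
        have c7 : (M : ℚ) ≤ (m : ℚ) + 1 := by
          have : M ≤ m + 1 := by omega
          exact_mod_cast this
        have c8 : 5 < ((m : ℚ) + 1) * δ i j := lt_of_lt_of_le hM (by gcongr)
        have c9 : (((m + 1).factorial : ℕ) : ℚ) = ((m : ℚ) + 1) * m.factorial := by
          rw [Nat.factorial_succ]; push_cast; ring
        rw [c9] at c4 c5
        have c10 : (u j (m + 1) + δ i j) * (((m : ℚ) + 1) * m.factorial) ≤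
            u i (m + 1) * (((m : ℚ) + 1) * m.factorial) :=
          mul_le_mul_of_nonneg_right hgp (by positivity)
        have c11 : 5 * (m.factorial : ℚ) ≤ ((m : ℚ) + 1) * δ i j * m.factorial :=
          mul_le_mul_of_nonneg_right c8.le (by positivity)
        have : ((cum (sz u j) (m + 1) + sz u j (m + 1) : ℕ) : ℚ) < (sz u i (m + 1) : ℚ) := by
          push_cast
          have c12 : 5 * (m.factorial : ℚ) < ((m : ℚ) + 1) * δ i j * m.factorial :=
            mul_lt_mul_of_pos_right c8 (by linarith)
          have key : u j (m + 1) * (((m : ℚ) + 1) * m.factorial) + 5 * (m.factorial : ℚ)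
              < sz u i (m + 1) + 1 := by
            have e1 : (u j (m + 1) + δ i j) * (((m : ℚ) + 1) * m.factorial) =
              u j (m + 1) * (((m : ℚ) + 1) * m.factorial)
                + ((m : ℚ) + 1) * δ i j * m.factorial := by ring
            linarith
          linarith
        exact_mod_cast this
      obtain ⟨x, hx1, hx2⟩ := escape (hone i) (hone j) hinj hk
      exact ⟨x, by rw [hx1]; omega, by rw [hx1]; exact hx2⟩)
    have := hred x
    simp only [Set.mem_ofPred_eq, idx_hm (hone _)] at this
    exact hx2 (this.1 hx1)
  refine ⟨{y | idx Nat.factorial y ∈ B}, fun i x => hm (sz u i) x, ?_, hm_comp hN, ?_, ?_, ?_, ?_,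
    hd, he, fun i j hij hD => ⟨hd i j hij, he j i hD⟩⟩
  · refine ⟨fun s n => g s (idx Nat.factorial n),
      hg.comp Computable.fst (hblk.comp Computable.snd), fun n => hgB _⟩
  · intro i y
    exact ⟨tr Nat.factorial (sz u i) y, by
      show hm (sz u i) _ = y
      rw [hm_tr fact_pos' (hlow i), hm_fact]⟩
  · intro k x hx y hy
    have ex : idx Nat.factorial x = k := idx_unique fact_pos' hx.1 hx.2
    have ey : idx Nat.factorial y = k := idx_unique fact_pos' hy.1 hy.2
    simp only [Set.mem_ofPred_eq, ex, ey]
  · intro i y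
    exact hm_fiber (hlow i) (hhigh i) y
  · intro i
    refine ⟨⟨hm (sz u i), (hm_comp hN).comp (Computable.const i) Computable.id,
      ⟨2, by norm_num, fun y => by exact_mod_cast hm_fiber (hlow i) (hhigh i) y⟩, fun x => Iff.rfl⟩,
      ⟨tr Nat.factorial (sz u i), tr_comp hF hN 0 i, ⟨1, le_refl _, fun y => ?_⟩, fun x => ?_⟩⟩
    · rw [Nat.cast_one, Set.encard_le_one_iff]
      intro a b ha hb
      exact tr_inj fact_pos' (hlow i) (ha.trans hb.symm)
    · show _ ↔ idx Nat.factorial (hm (sz u i) (tr Nat.factorial (sz u i) x)) ∈ B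
      rw [hm_tr fact_pos' (hlow i), hm_fact]
      exact Iff.rfl
end

section
/- Universal countable partial orders corollary. There exists a nonrecursive limit computable set A ⊆ ℕ such that every countable partial order embeds into the partially ordered set of 1-degrees contained in the bounded finite-one degree of A. Precisely: there exists such an A with the property that for every countable type P equipped with a partial order ≤_P, there is a map e : P → Set ℕ such that e(p) ≡_bfo A for every p ∈ P, and for all p, q ∈ P: e(p) ≤₁ e(q) if and only if p ≤_P q. -/
namespace UCPO

open Nat.Partrec (Code)

/-- Value of the `e`-th code at (bounded) computation `t`; `0` when undefined. -/
def val (e t : ℕ) : ℕ :=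
  (Code.evaln t.unpair.1 (Denumerable.ofNat Code e) t.unpair.2).getD 0

/-- The computation `t` yields a pair usable for diagonalization above `m`. -/
def good (e m t : ℕ) : Prop :=
  (val e t).unpair.1 ≠ (val e t).unpair.2 ∧ m ≤ max (val e t).unpair.1 (val e t).unpair.2

instance (e m t : ℕ) : Decidable (good e m t) := by unfold good; infer_instance

/-- Bounded search. -/
def srch (e m : ℕ) (s : ℕ) : ℕ :=
  Nat.rec 0 (fun k r => if good e m r then r else k + 1) s

/-- One step of the finite extension construction. -/
def step (s e : ℕ) (p : ℕ × List ℕ) : ℕ × List ℕ :=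
  if good e p.1 (srch e p.1 s) then
    (max (val e (srch e p.1 s)).unpair.1 (val e (srch e p.1 s)).unpair.2 + 1,
      if ∃ a ∈ p.2, a = min (val e (srch e p.1 s)).unpair.1 (val e (srch e p.1 s)).unpair.2 then p.2
      else max (val e (srch e p.1 s)).unpair.1 (val e (srch e p.1 s)).unpair.2 :: p.2)
  else (p.1 + 1, p.2)

/-- Approximation at stage `s` to the `e`-th finite condition. -/
def st (s e : ℕ) : ℕ × List ℕ :=
  Nat.rec (0, []) (fun k p => step s k p) e

theorem val_primrec : Primrec₂ val := by
  unfold val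
  have h := Code.primrec_evaln
  have h2 : Primrec fun p : ℕ × ℕ =>
      ((p.2.unpair.1, Denumerable.ofNat Code p.1), p.2.unpair.2) := by
    refine Primrec.pair (Primrec.pair ?_ ?_) ?_
    · exact Primrec.fst.comp (Primrec.unpair.comp Primrec.snd)
    · exact (Primrec.ofNat Code).comp Primrec.fst
    · exact Primrec.snd.comp (Primrec.unpair.comp Primrec.snd)
  exact Primrec.option_getD.comp (h.comp h2) (Primrec.const 0)

theorem good_primrec {α : Type} [Primcodable α] {e m t : α → ℕ} (he : Primrec e) (hm : Primrec m)
    (ht : Primrec t) : PrimrecPred (fun a => good (e a) (m a) (t a)) := by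
  unfold good
  have hv : Primrec fun a => val (e a) (t a) := val_primrec.comp he ht
  have h1 : Primrec fun a => (val (e a) (t a)).unpair.1 := Primrec.fst.comp (Primrec.unpair.comp hv)
  have h2 : Primrec fun a => (val (e a) (t a)).unpair.2 := Primrec.snd.comp (Primrec.unpair.comp hv)
  exact PrimrecPred.and (PrimrecPred.not (Primrec.eq.comp h1 h2))
    (Primrec.nat_le.comp hm (Primrec.nat_max.comp h1 h2))

theorem srch_primrec {α : Type} [Primcodable α] {e m s : α → ℕ} (he : Primrec e) (hm : Primrec m)
    (hs : Primrec s) : Primrec (fun a => srch (e a) (m a) (s a)) := by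
  unfold srch
  refine Primrec.nat_rec' (h := fun a p => if good (e a) (m a) p.2 then p.2 else p.1 + 1)
    hs (Primrec.const 0) ?_
  refine Primrec.ite (good_primrec (he.comp Primrec.fst) (hm.comp Primrec.fst)
    (Primrec.snd.comp Primrec.snd)) (Primrec.snd.comp Primrec.snd) ?_
  exact Primrec.succ.comp (Primrec.fst.comp Primrec.snd)

theorem mem_primrec {α : Type} [Primcodable α] {l : α → List ℕ} {n : α → ℕ} (hl : Primrec l)
    (hn : Primrec n) : PrimrecPred (fun a => ∃ b ∈ l a, b = n a) := by
  have h : PrimrecRel (fun (L : List ℕ) (b : ℕ) => ∃ a ∈ L, a = b) :=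
    PrimrecRel.exists_mem_list Primrec.eq
  exact h.comp hl hn

theorem step_primrec {α : Type} [Primcodable α] {s e : α → ℕ} {p : α → ℕ × List ℕ}
    (hs : Primrec s) (he : Primrec e) (hp : Primrec p) :
    Primrec (fun a => step (s a) (e a) (p a)) := by
  unfold step
  have hp1 : Primrec fun a => (p a).1 := Primrec.fst.comp hp
  have hp2 : Primrec fun a => (p a).2 := Primrec.snd.comp hp
  have hr := srch_primrec he hp1 hs
  have hv : Primrec fun a => val (e a) (srch (e a) (p a).1 (s a)) := val_primrec.comp he hr
  have h1 := Primrec.fst.comp (Primrec.unpair.comp hv)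
  have h2 := Primrec.snd.comp (Primrec.unpair.comp hv)
  have hM := Primrec.nat_max.comp h1 h2
  have hm := Primrec.nat_min.comp h1 h2
  refine Primrec.ite (good_primrec he hp1 hr) (Primrec.pair (Primrec.succ.comp hM) ?_)
    (Primrec.pair (Primrec.succ.comp hp1) hp2)
  exact Primrec.ite (mem_primrec hp2 hm) hp2 (Primrec.list_cons.comp hM hp2)

theorem st_primrec {α : Type} [Primcodable α] {s e : α → ℕ}
    (hs : Primrec s) (he : Primrec e) : Primrec (fun a => st (s a) (e a)) := by
  unfold st
  refine Primrec.nat_rec' (h := fun a (p : ℕ × (ℕ × List ℕ)) => step (s a) p.1 p.2)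
    he (Primrec.const ((0, []) : ℕ × List ℕ)) ?_
  exact step_primrec (hs.comp Primrec.fst) (Primrec.fst.comp Primrec.snd)
    (Primrec.snd.comp Primrec.snd)

theorem srch_stable (e m : ℕ) : ∃ s₀, ∀ s, s₀ ≤ s → (srch e m s = srch e m s₀ ∨
    ((∀ t, ¬ good e m t))) ∧ ((∃ t, good e m t) → good e m (srch e m s)) := by
  by_cases h : ∃ t, good e m t
  · have hlt : ∀ s, s ≤ Nat.find h → srch e m s = s := by
      intro s
      induction s with
      | zero => intro _; rfl
      | succ k ih =>
        intro hk
        have h1 := ih (by omega)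
        have h2 : ¬ good e m k := Nat.find_min h (by omega)
        change (if good e m (srch e m k) then srch e m k else k + 1) = k + 1
        rw [h1, if_neg h2]
    have hge : ∀ d, srch e m (Nat.find h + d) = Nat.find h := by
      intro d
      induction d with
      | zero => exact hlt _ le_rfl
      | succ k ih =>
        change (if good e m (srch e m (Nat.find h + k)) then srch e m (Nat.find h + k)
          else Nat.find h + k + 1) = _
        rw [ih, if_pos (Nat.find_spec h)]
    refine ⟨Nat.find h, fun s hs => ?_⟩
    obtain ⟨d, rfl⟩ := Nat.exists_eq_add_of_le hs
    refine ⟨Or.inl ?_, fun _ => ?_⟩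
    · rw [hge, hlt _ le_rfl]
    · rw [hge]; exact Nat.find_spec h
  · exact ⟨0, fun s _ => ⟨Or.inr (not_exists.1 h), fun h' => absurd h' h⟩⟩

theorem step_stable (e : ℕ) (p : ℕ × List ℕ) : ∃ s₀, ∀ s, s₀ ≤ s → step s e p = step s₀ e p := by
  obtain ⟨s₀, h⟩ := srch_stable e p.1
  refine ⟨s₀, fun s hs => ?_⟩
  rcases (h s hs).1 with h1 | h1
  · unfold step; rw [h1]
  · unfold step; rw [if_neg (h1 _), if_neg (h1 _)]

theorem st_stable (e : ℕ) : ∃ s₀, ∀ s, s₀ ≤ s → st s e = st s₀ e := by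
  induction e with
  | zero => exact ⟨0, fun _ _ => rfl⟩
  | succ k ih =>
    obtain ⟨s₁, h1⟩ := ih
    obtain ⟨s₂, h2⟩ := step_stable k (st s₁ k)
    refine ⟨max s₁ s₂, fun s hs => ?_⟩
    change step s k (st s k) = step (max s₁ s₂) k (st (max s₁ s₂) k)
    rw [h1 s (by omega), h1 (max s₁ s₂) (by omega), h2 s (by omega), h2 (max s₁ s₂) (by omega)]

theorem st_succ (s e : ℕ) : st s (e + 1) = step s e (st s e) := rfl

theorem step_lt (s e : ℕ) (p : ℕ × List ℕ) : p.1 < (step s e p).1 := by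
  unfold step
  by_cases h : good e p.1 (srch e p.1 s)
  · rw [if_pos h]
    have := h.2
    show _ < _ + 1
    omega
  · rw [if_neg h]
    show _ < _ + 1
    omega

theorem step_mem (s e : ℕ) (p : ℕ × List ℕ) (n : ℕ) (hn : n < p.1) :
    n ∈ (step s e p).2 ↔ n ∈ p.2 := by
  unfold step
  split_ifs with h h'
  · rfl
  · have := h.2
    simp only [List.mem_cons, or_iff_right_iff_imp]
    intro h3; omega
  · rfl

theorem step_bdd (s e : ℕ) (p : ℕ × List ℕ) (hp : ∀ n ∈ p.2, n < p.1) :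
    ∀ n ∈ (step s e p).2, n < (step s e p).1 := by
  intro n hn
  have hl := step_lt s e p
  by_cases hh : n < p.1
  · omega
  · have hnp : n ∉ p.2 := fun h => hh (hp n h)
    revert hn
    unfold step
    split_ifs with h h'
    · intro hn; exact absurd hn hnp
    · simp only [List.mem_cons]
      rintro (h3 | h3)
      · omega
      · exact absurd h3 hnp
    · intro hn; exact absurd hn hnp

theorem st_bdd (s e : ℕ) : ∀ n ∈ (st s e).2, n < (st s e).1 := by
  induction e with
  | zero => intro n hn; simp [st] at hn
  | succ k ih => rw [st_succ]; exact step_bdd s k _ ih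

theorem st_len (s e : ℕ) : e ≤ (st s e).1 := by
  induction e with
  | zero => exact Nat.zero_le _
  | succ k ih => rw [st_succ]; have := step_lt s k (st s k); omega

theorem st_mem_add (s e d n : ℕ) (hn : n < (st s e).1) :
    n < (st s (e + d)).1 ∧ (n ∈ (st s (e + d)).2 ↔ n ∈ (st s e).2) := by
  induction d with
  | zero => exact ⟨hn, Iff.rfl⟩
  | succ k ih =>
    rw [← Nat.add_assoc, st_succ]
    have := step_lt s (e + k) (st s (e + k))
    exact ⟨by omega, (step_mem _ _ _ _ ih.1).trans ih.2⟩

theorem st_mem_eq (s e e' n : ℕ) (hn : n < (st s e).1) (hn' : n < (st s e').1) :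
    n ∈ (st s e).2 ↔ n ∈ (st s e').2 := by
  rcases le_total e e' with h | h
  · obtain ⟨d, rfl⟩ := Nat.exists_eq_add_of_le h
    exact (st_mem_add s e d n hn).2.symm
  · obtain ⟨d, rfl⟩ := Nat.exists_eq_add_of_le h
    have key := st_mem_add s e' d n hn'
    exact key.right

/-- The constructed set. -/
def setA : Set ℕ := {n | ∃ s₀, ∀ s, s₀ ≤ s → n ∈ (st s (n + 1)).2}

open Classical in
/-- Its computable approximation. -/
noncomputable def approx (s n : ℕ) : Bool := decide (∃ b ∈ (st s (n + 1)).2, b = n)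

theorem approx_computable : Computable₂ approx := by
  have h : PrimrecPred (fun a : ℕ × ℕ => ∃ b ∈ (st a.1 (a.2 + 1)).2, b = a.2) :=
    mem_primrec (Primrec.snd.comp (st_primrec Primrec.fst (Primrec.succ.comp Primrec.snd)))
      Primrec.snd
  obtain ⟨_, h⟩ := h
  refine h.to_comp.of_eq fun a => ?_
  unfold approx
  rw [decide_eq_decide]

theorem approx_lim (n : ℕ) : ∃ s₀, ∀ s, s₀ ≤ s → (n ∈ (st s (n + 1)).2 ↔ n ∈ setA) := by
  obtain ⟨s₀, h⟩ := st_stable (n + 1)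
  refine ⟨s₀, fun s hs => ?_⟩
  rw [h s hs]
  constructor
  · intro hn; exact ⟨s₀, fun t ht => by rw [h t ht]; exact hn⟩
  · rintro ⟨s₁, h1⟩
    have := h1 (max s₀ s₁) (by omega)
    rwa [h _ (by omega)] at this

theorem setA_limit : LimitComputable setA := by
  refine ⟨approx, approx_computable, fun n => ?_⟩
  obtain ⟨s₀, h⟩ := approx_lim n
  refine ⟨s₀, fun s hs => ?_⟩
  rw [← h s hs]
  simp [approx]

theorem step_diag (s e : ℕ) (p : ℕ × List ℕ) (hp : ∀ n ∈ p.2, n < p.1)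
    (h : good e p.1 (srch e p.1 s)) : ∃ t,
    (val e t).unpair.1 ≠ (val e t).unpair.2 ∧ (val e t).unpair.1 < (step s e p).1 ∧
    (val e t).unpair.2 < (step s e p).1 ∧
    ¬ ((val e t).unpair.1 ∈ (step s e p).2 ↔ (val e t).unpair.2 ∈ (step s e p).2) := by
  refine ⟨srch e p.1 s, h.1, ?_⟩
  unfold step
  rw [if_pos h]
  obtain ⟨h1, h2⟩ := h
  generalize (val e (srch e p.1 s)).unpair.1 = a at *
  generalize (val e (srch e p.1 s)).unpair.2 = b at *
  refine ⟨by show _ < _ + 1; omega, by show _ < _ + 1; omega, ?_⟩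
  have hM : max a b ∉ p.2 := fun hh => by have := hp _ hh; omega
  simp only [exists_eq_right]
  rcases lt_or_gt_of_ne h1 with hlt | hlt
  · rw [max_eq_right hlt.le] at *
    rw [min_eq_left hlt.le]
    split_ifs with h3
    · tauto
    · simp only [List.mem_cons]; tauto
  · rw [max_eq_left hlt.le] at *
    rw [min_eq_right hlt.le]
    split_ifs with h3
    · tauto
    · simp only [List.mem_cons]
      have : ¬ b = a := fun h => h1 h.symm
      tauto

/-- Rigidity of the constructed set. -/
theorem setA_rigid (f F : ℕ → ℕ) (hf : Computable f) (hF : Computable F)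
    (h : ∀ x, f x ∈ setA ↔ F x ∈ setA) :
    ∃ m, ∀ x, f x ≠ F x → f x < m ∧ F x < m := by
  have hc : Computable fun x => Nat.pair (f x) (F x) :=
    (Primrec₂.natPair.to_comp).comp hf hF
  obtain ⟨c, hc⟩ := Code.exists_code.1 (Partrec.nat_iff.1 hc)
  set e := Encodable.encode c with he
  have hval : ∀ x, ∃ t, val e t = Nat.pair (f x) (F x) := by
    intro x
    have : Nat.pair (f x) (F x) ∈ Code.eval c x := by rw [hc]; simp
    obtain ⟨k, hk⟩ := Code.evaln_complete.1 this
    refine ⟨Nat.pair k x, ?_⟩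
    unfold val
    simp only [Nat.unpair_pair, he, Denumerable.ofNat_encode]
    rw [Option.mem_def.1 hk]; rfl
  have hval' : ∀ t, (val e t).unpair.1 ≠ (val e t).unpair.2 →
      ∃ x, val e t = Nat.pair (f x) (F x) := by
    intro t ht
    unfold val at ht ⊢
    simp only [he, Denumerable.ofNat_encode] at ht ⊢
    cases hk : Code.evaln t.unpair.1 c t.unpair.2 with
    | none => rw [hk] at ht; simp at ht
    | some v =>
      have := Code.evaln_sound (Option.mem_def.2 hk)
      rw [hc] at this
      exact ⟨t.unpair.2, by simpa using this⟩
  by_contra hcon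
  push Not at hcon
  obtain ⟨s₁, h1⟩ := st_stable e
  obtain ⟨s₂, h2⟩ := srch_stable e (st s₁ e).1
  have hex : ∃ t, good e (st s₁ e).1 t := by
    obtain ⟨x, hx, hx2⟩ := hcon (st s₁ e).1
    obtain ⟨t, ht⟩ := hval x
    refine ⟨t, ?_⟩
    unfold good
    rw [ht, Nat.unpair_pair]
    refine ⟨hx, ?_⟩
    by_cases h3 : f x < (st s₁ e).1
    · exact le_trans (hx2 h3) (le_max_right _ _)
    · exact le_trans (not_lt.1 h3) (le_max_left _ _)
  obtain ⟨s₃, h3⟩ := st_stable (e + 1)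
  set s' := max s₁ (max s₂ s₃) with hs'
  have hg : good e (st s' e).1 (srch e (st s' e).1 s') := by
    rw [h1 s' (by omega)]
    exact (h2 s' (by omega)).2 hex
  obtain ⟨t, ht1, ht2, ht3, ht4⟩ := step_diag s' e (st s' e) (st_bdd _ _) hg
  rw [← st_succ] at ht2 ht3 ht4
  obtain ⟨x, hx⟩ := hval' t ht1
  rw [hx, Nat.unpair_pair] at ht2 ht3 ht4
  simp only at ht2 ht3 ht4
  have key : ∀ n, n < (st s' (e + 1)).1 → (n ∈ (st s' (e + 1)).2 ↔ n ∈ setA) := by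
    intro n hn
    obtain ⟨s₄, h4⟩ := approx_lim n
    rw [← h4 (max s' s₄) (by omega)]
    have e1 : st s' (e + 1) = st (max s' s₄) (e + 1) := by
      rw [h3 s' (by omega), h3 (max s' s₄) (by omega)]
    rw [e1] at hn ⊢
    exact st_mem_eq _ _ _ _ hn (by have := st_len (max s' s₄) (n + 1); omega)
  rw [key _ ht2, key _ ht3] at ht4
  exact ht4 (h x)

theorem setA_nonrec : ¬ ComputablePred (· ∈ setA) := by
  rintro ⟨hd, hc⟩
  let q : ℕ → Bool := fun n => decide (n ∈ setA)
  have hq : Computable q := hc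
  have h3 : Computable fun x : ℕ => 3 * x :=
    (Primrec.nat_mul.comp (Primrec.const 3) Primrec.id).to_comp
  have h31 : Computable fun x : ℕ => 3 * x + 1 := Computable.succ.comp h3
  have h32 : Computable fun x : ℕ => 3 * x + 2 := Computable.succ.comp h31
  have hbeq : Computable₂ (fun a b : Bool => a == b) := Primrec.beq.to_comp
  let c1 : ℕ → Bool := fun x => q (3 * x) == q (3 * x + 1)
  let c2 : ℕ → Bool := fun x => q (3 * x) == q (3 * x + 2)
  have hc1 : Computable c1 := hbeq.comp (hq.comp h3) (hq.comp h31)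
  have hc2 : Computable c2 := hbeq.comp (hq.comp h3) (hq.comp h32)
  obtain ⟨m, hm⟩ := setA_rigid
    (fun x => bif c1 x then 3 * x else bif c2 x then 3 * x else 3 * x + 1)
    (fun x => bif c1 x then 3 * x + 1 else 3 * x + 2)
    (Computable.cond hc1 h3 (Computable.cond hc2 h3 h31))
    (Computable.cond hc1 h31 h32) (by
      intro x
      by_cases a0 : 3 * x ∈ setA <;> by_cases a1 : 3 * x + 1 ∈ setA <;>
        by_cases a2 : 3 * x + 2 ∈ setA <;> simp [c1, c2, q, a0, a1, a2])
  have := hm m (by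
    cases c1 m <;> cases c2 m <;> simp)
  revert this
  cases c1 m <;> cases c2 m <;> simp <;> omega

end UCPO
namespace UCPO

theorem lift_computable (f g : ℕ → ℕ) (hf : Computable f) (hg : Computable g)
    (h : ∀ x, ∃ y, f y = g x) : ∃ k : ℕ → ℕ, Computable k ∧ ∀ x, f (k x) = g x := by
  classical
  have hp : Computable₂ (fun x n : ℕ => decide (f n = g x)) := by
    have : PrimrecRel (fun a b : ℕ => a = b) := Primrec.eq
    exact (this.decide.to_comp).comp (hf.comp Computable.snd) (hg.comp Computable.fst)
  have hr : Partrec fun x => Nat.rfind (fun n => Part.some (decide (f n = g x))) :=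
    Partrec.rfind hp.partrec₂
  refine ⟨fun x => Nat.find (h x), hr.of_eq_tot ?_, fun x => Nat.find_spec (h x)⟩
  intro x
  refine Nat.mem_rfind.2 ⟨by simpa using Nat.find_spec (h x), fun {m} hm => ?_⟩
  simpa using Nat.find_min (h x) hm

/-- Successor in `{v | v even or v / 2 ∈ S}`. -/
def nxt (S : ℕ → Bool) (v : ℕ) : ℕ :=
  bif (v % 2 == 0) && !(S (v / 2)) then v + 2 else v + 1

/-- Increasing enumeration of `{v | v even or v / 2 ∈ S}`. -/
def enm (S : ℕ → Bool) (x : ℕ) : ℕ := Nat.rec 0 (fun _ v => nxt S v) x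

theorem enm_succ (S : ℕ → Bool) (x : ℕ) : enm S (x + 1) = nxt S (enm S x) := rfl

theorem enm_computable (S : ℕ → Bool) (hS : Computable S) : Computable (enm S) := by
  have hb : Computable fun v : ℕ => (v % 2 == 0) :=
    (Primrec.beq.comp (Primrec.nat_mod.comp Primrec.id (Primrec.const 2)) (Primrec.const 0)).to_comp
  have hd : Computable fun v : ℕ => v / 2 :=
    (Primrec.nat_div.comp Primrec.id (Primrec.const 2)).to_comp
  have hn : Computable (nxt S) := by
    unfold nxt
    exact Computable.cond ((Primrec.and.to_comp).comp hb (Primrec.not.to_comp.comp (hS.comp hd)))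
      (Computable.succ.comp Computable.succ : Computable fun v : ℕ => v + 2) Computable.succ
  have h2 : Computable₂ (fun (_ : ℕ) (p : ℕ × ℕ) => nxt S p.2) :=
    hn.comp (Computable.snd.comp Computable.snd)
  exact Computable.nat_rec (f := fun x : ℕ => x) (g := fun _ => 0) Computable.id
    (Computable.const 0) h2

theorem enm_strictMono (S : ℕ → Bool) : StrictMono (enm S) := by
  refine strictMono_nat_of_lt_succ fun n => ?_
  rw [enm_succ]
  unfold nxt
  cases (enm S n % 2 == 0) && !(S (enm S n / 2)) <;> simp

theorem enm_mem (S : ℕ → Bool) (x : ℕ) : enm S x % 2 = 0 ∨ S (enm S x / 2) = true := by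
  induction x with
  | zero => left; rfl
  | succ k ih =>
    rw [enm_succ]
    generalize enm S k = v at *
    unfold nxt
    rcases Nat.mod_two_eq_zero_or_one v with h | h
    · cases hS : S (v / 2)
      · left; simp [h]
      · right
        have : (v + 1) / 2 = v / 2 := by omega
        simp [this, hS]
    · left; simp [h]; omega

theorem enm_surj (S : ℕ → Bool) (v : ℕ) : (v % 2 = 0 ∨ S (v / 2) = true) → ∃ x, enm S x = v := by
  induction v using Nat.strong_induction_on with
  | _ v ih =>
    intro hv
    rcases Nat.eq_zero_or_pos v with rfl | hpos
    · exact ⟨0, rfl⟩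
    rcases Nat.mod_two_eq_zero_or_one v with h | h
    · cases hS : S ((v - 2) / 2)
      · obtain ⟨x, hx⟩ := ih (v - 2) (by omega) (by left; omega)
        refine ⟨x + 1, ?_⟩
        rw [enm_succ, hx]
        have h2 : (v - 2) % 2 = 0 := by omega
        simp [nxt, hS, h2]; omega
      · have e1 : (v - 1) / 2 = (v - 2) / 2 := by omega
        obtain ⟨x, hx⟩ := ih (v - 1) (by omega) (by right; rw [e1]; exact hS)
        refine ⟨x + 1, ?_⟩
        rw [enm_succ, hx]
        simp [nxt, hS, e1]; omega
    · have hS : S (v / 2) = true := by rcases hv with h' | h'; omega; exact h'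
      have e1 : (v - 1) / 2 = v / 2 := by omega
      obtain ⟨x, hx⟩ := ih (v - 1) (by omega) (by left; omega)
      refine ⟨x + 1, ?_⟩
      rw [enm_succ, hx]
      simp [nxt, hS, e1]; omega

/-- `A` with the elements of index in `S` duplicated. -/
def dup (A : Set ℕ) (S : ℕ → Bool) : Set ℕ := {x | enm S x / 2 ∈ A}

theorem dup_mono (A : Set ℕ) (S T : ℕ → Bool) (hS : Computable S) (hT : Computable T)
    (h : ∀ y, S y = true → T y = true) : OneOneRed (dup A S) (dup A T) := by
  obtain ⟨k, hk, hk'⟩ := lift_computable (enm T) (enm S) (enm_computable T hT)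
    (enm_computable S hS) (fun x => enm_surj T _ ((enm_mem S x).imp id (h _)))
  refine ⟨k, hk, fun a b hab => (enm_strictMono S).injective ?_, fun x => ?_⟩
  · rw [← hk', ← hk', hab]
  · show enm S x / 2 ∈ A ↔ enm T (k x) / 2 ∈ A
    rw [hk']

theorem enm_empty (x : ℕ) : enm (fun _ => false) x = 2 * x := by
  induction x with
  | zero => rfl
  | succ k ih => rw [enm_succ, ih]; simp [nxt]; omega

theorem dup_empty (A : Set ℕ) : dup A (fun _ => false) = A := by
  ext x
  show enm _ x / 2 ∈ A ↔ _
  rw [enm_empty]; simp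

theorem OneOneRed.bfo {B C : Set ℕ} (h : OneOneRed B C) : BfoRed B C := by
  obtain ⟨f, hf, hi, hr⟩ := h
  refine ⟨f, hf, ⟨1, le_rfl, fun y => ?_⟩, hr⟩
  rw [Nat.cast_one, Set.encard_le_one_iff]
  intro a b ha hb
  exact hi (ha.trans hb.symm)

theorem dup_bfo (A : Set ℕ) (S : ℕ → Bool) (hS : Computable S) : BfoEquiv (dup A S) A := by
  constructor
  · refine ⟨fun x => enm S x / 2, ?_, ⟨2, by norm_num, fun y => ?_⟩, fun x => Iff.rfl⟩
    · exact (Primrec.nat_div.comp Primrec.id (Primrec.const 2)).to_comp.comp (enm_computable S hS)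
    · have h1 : ({x | enm S x / 2 = y} : Set ℕ).encard ≤ ({2 * y, 2 * y + 1} : Set ℕ).encard := by
        refine Set.encard_le_encard_of_injOn (f := enm S) (fun x hx => ?_)
          ((enm_strictMono S).injective.injOn)
        have : enm S x / 2 = y := hx
        simp only [Set.mem_insert_iff, Set.mem_singleton_iff]
        omega
      exact h1.trans (by rw [Set.encard_pair (by omega)]; rfl)
  · have := dup_mono A (fun _ => false) S (Computable.const false) hS (by simp)
    rw [dup_empty] at this
    exact OneOneRed.bfo this

theorem dup_reflect (S T : ℕ → Bool) (hS : Computable S) (hT : Computable T)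
    (h : OneOneRed (dup setA S) (dup setA T)) : ∃ m, ∀ y, m ≤ y → S y = true → T y = true := by
  obtain ⟨k, hk, hi, hr⟩ := h
  have hd : Computable fun v : ℕ => v / 2 :=
    (Primrec.nat_div.comp Primrec.id (Primrec.const 2)).to_comp
  obtain ⟨m, hm⟩ := setA_rigid (fun x => enm S x / 2) (fun x => enm T (k x) / 2)
    (hd.comp (enm_computable S hS)) (hd.comp ((enm_computable T hT).comp hk)) hr
  refine ⟨m, fun y hy hSy => ?_⟩
  by_contra hTy
  obtain ⟨x0, h0⟩ := enm_surj S (2 * y) (by left; omega)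
  obtain ⟨x1, h1⟩ := enm_surj S (2 * y + 1) (by
    right
    rwa [show (2 * y + 1) / 2 = y by omega])
  have key : ∀ x, enm S x / 2 = y → enm T (k x) = 2 * y := by
    intro x hx
    have e1 : enm T (k x) / 2 = y := by
      by_contra hne
      have := (hm x (by rw [hx]; exact fun h => hne h.symm)).1
      simp only [hx] at this
      omega
    rcases enm_mem T (k x) with h2 | h2
    · omega
    · rw [e1] at h2; exact absurd h2 hTy
  have e := (key x0 (by omega)).trans (key x1 (by omega)).symm
  have := hi ((enm_strictMono T).injective e)
  rw [this] at h0
  omega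

/-- Retraction of Cantor space onto the upward closed sets of `R`. -/
def retr (R : ℕ → ℕ → Prop) (x : ℕ → Bool) (n : ℕ) : Prop :=
  (∃ i, ∃ _ : i < n, R i n ∧ retr R x i) ∨
    ((∀ j, ∀ _ : j < n, R n j → retr R x j) ∧ x n = true)
termination_by n

theorem retr_up (R : ℕ → ℕ → Prop) (hR : ∀ a b c, R a b → R b c → R a c) (x : ℕ → Bool) (n : ℕ) :
    ∀ i j, i < n → j < n → R i j → retr R x i → retr R x j := by
  induction n with
  | zero => intro i j hi; omega
  | succ n ih =>
    intro i j hi hj hij hri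
    rcases lt_trichotomy i j with h | h | h
    · rw [retr]; exact Or.inl ⟨i, h, hij, hri⟩
    · rw [← h]; exact hri
    · rw [retr] at hri
      rcases hri with ⟨i', hi', hR', hr'⟩ | ⟨h2, _⟩
      · exact ih i' j (by omega) (by omega) (hR _ _ _ hR' hij) hr'
      · exact h2 j h hij

theorem retr_fix (R : ℕ → ℕ → Prop) (x : ℕ → Bool) (N : ℕ)
    (hx : ∀ i j, i < N → j < N → R i j → x i = true → x j = true) (n : ℕ) (hn : n < N) :
    retr R x n ↔ x n = true := by
  induction n using Nat.strong_induction_on with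
  | _ n ih =>
    rw [retr]
    constructor
    · rintro (⟨i, hi, hR, hr⟩ | ⟨_, h⟩)
      · exact hx i n (by omega) hn hR ((ih i hi (by omega)).1 hr)
      · exact h
    · intro h
      exact Or.inr ⟨fun j hj hR => (ih j hj (by omega)).2 (hx n j hn (by omega) hR h), h⟩

theorem retr_congr (R : ℕ → ℕ → Prop) (x x' : ℕ → Bool) (n : ℕ) (h : ∀ i, i ≤ n → x i = x' i) :
    retr R x n ↔ retr R x' n := by
  induction n using Nat.strong_induction_on with
  | _ n ih =>
    have h' : ∀ i, i < n → (retr R x i ↔ retr R x' i) :=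
      fun i hi => ih i hi (fun k hk => h k (by omega))
    rw [retr, retr, h n le_rfl]
    constructor
    · rintro (⟨i, hi, hR, hr⟩ | ⟨h1, h2⟩)
      · exact Or.inl ⟨i, hi, hR, (h' i hi).1 hr⟩
      · exact Or.inr ⟨fun j hj hR => (h' j hj).1 (h1 j hj hR), h2⟩
    · rintro (⟨i, hi, hR, hr⟩ | ⟨h1, h2⟩)
      · exact Or.inl ⟨i, hi, hR, (h' i hi).2 hr⟩
      · exact Or.inr ⟨fun j hj hR => (h' j hj).2 (h1 j hj hR), h2⟩

open Classical in
/-- The periodic sets representing the order. -/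
noncomputable def cyl (R : ℕ → ℕ → Prop) (n m : ℕ) : Bool := decide (retr R m.testBit n)

theorem cyl_computable (R : ℕ → ℕ → Prop) (n : ℕ) : Computable (cyl R n) := by
  have h : cyl R n = fun m =>
      ((List.range (2 ^ (n + 1))).map (cyl R n)).getD (m % 2 ^ (n + 1)) false := by
    funext m
    have hlt : m % 2 ^ (n + 1) < 2 ^ (n + 1) := Nat.mod_lt _ (by positivity)
    have e1 : cyl R n m = cyl R n (m % 2 ^ (n + 1)) := by
      unfold cyl
      rw [decide_eq_decide]
      refine retr_congr R _ _ n fun i hi => ?_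
      rw [Nat.testBit_mod_two_pow]
      simp; omega
    rw [e1, List.getD_eq_getElem _ _ (by simpa using hlt)]
    simp
  rw [h]
  exact ((Primrec.list_getD false).comp (Primrec.const _)
    (Primrec.nat_mod.comp Primrec.id (Primrec.const _))).to_comp

theorem exists_bits (N : ℕ) : ∀ x : ℕ → Bool, ∃ M : ℕ, ∀ k, k < N → M.testBit k = x k := by
  induction N with
  | zero => intro x; exact ⟨0, fun k hk => by omega⟩
  | succ N ih =>
    intro x
    obtain ⟨M, hM⟩ := ih (fun k => x (k + 1))
    refine ⟨Nat.bit (x 0) M, fun k hk => ?_⟩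
    cases k with
    | zero => exact Nat.testBit_bit_zero _ _
    | succ k => rw [Nat.testBit_bit_succ]; exact hM k (by omega)

theorem cyl_mono (R : ℕ → ℕ → Prop) (hR : ∀ a b c, R a b → R b c → R a c) (i j : ℕ) (h : R i j)
    (m : ℕ) : cyl R i m = true → cyl R j m = true := by
  unfold cyl
  simp only [decide_eq_true_eq]
  exact retr_up R hR _ (i + j + 1) i j (by omega) (by omega) h

theorem cyl_reflect (R : ℕ → ℕ → Prop) (hR : ∀ a b c, R a b → R b c → R a c) (i j : ℕ)
    (hi : R i i) (h : ¬ R i j) (b : ℕ) : ∃ m, b ≤ m ∧ cyl R i m = true ∧ ¬ cyl R j m = true := by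
  classical
  let N := i + j + 1
  let x : ℕ → Bool := fun k => if k < N then decide (R i k) else true
  obtain ⟨M, hM⟩ := exists_bits (N + b + 1) x
  have hx : ∀ k, k < N → M.testBit k = decide (R i k) := by
    intro k hk
    rw [hM k (by omega)]
    simp [x, hk]
  have hfix := retr_fix R M.testBit N (by
    intro a c ha hc hac
    rw [hx a ha, hx c hc]
    simp only [decide_eq_true_eq]
    exact fun h => hR _ _ _ h hac)
  refine ⟨M, ?_, ?_, ?_⟩
  · have h1 : M.testBit (N + b) = true := by
      rw [hM _ (by omega)]
      simp [x]
    have h2 := Nat.ge_two_pow_of_testBit h1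
    have h3 : N + b < 2 ^ (N + b) := Nat.lt_two_pow_self
    omega
  · unfold cyl
    rw [decide_eq_true_eq, hfix i (by omega), hx i (by omega)]
    simpa using hi
  · unfold cyl
    rw [decide_eq_true_eq, hfix j (by omega), hx j (by omega)]
    simpa using h

end UCPO

/-- **Universal countable partial orders corollary.**  There is a nonrecursive
limit computable set `A` such that every countable partial order embeds into
the 1-degrees contained in the bounded finite-one degree of `A`: for every
countable type `P` with a partial order, there is `e : P → Set ℕ` with
`e p ≡_bfo A` for every `p` and `e p ≤₁ e q ↔ p ≤ q`. -/
theorem universal_countable_partial_orders :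
    ∃ A : Set ℕ,
      ¬ ComputablePred (· ∈ A) ∧
      LimitComputable A ∧
      ∀ (P : Type) [Countable P] [PartialOrder P],
        ∃ e : P → Set ℕ,
          (∀ p, BfoEquiv (e p) A) ∧
          (∀ p q : P, OneOneRed (e p) (e q) ↔ p ≤ q) := by
  refine ⟨UCPO.setA, UCPO.setA_nonrec, UCPO.setA_limit, ?_⟩
  intro P _ _
  obtain ⟨ι, hι⟩ := Countable.exists_injective_nat P
  let R : ℕ → ℕ → Prop := fun i j => ∃ p q, ι p = i ∧ ι q = j ∧ p ≤ q
  have hR : ∀ a b c, R a b → R b c → R a c := by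
    rintro a b c ⟨p, q, rfl, rfl, h⟩ ⟨q', r, h1, rfl, h2⟩
    rw [hι h1] at h2
    exact ⟨p, r, rfl, rfl, h.trans h2⟩
  have hR' : ∀ p q : P, R (ι p) (ι q) ↔ p ≤ q := by
    intro p q
    constructor
    · rintro ⟨p', q', h1, h2, h⟩
      rwa [hι h1, hι h2] at h
    · intro h
      exact ⟨p, q, rfl, rfl, h⟩
  refine ⟨fun p => UCPO.dup UCPO.setA (UCPO.cyl R (ι p)),
    fun p => UCPO.dup_bfo _ _ (UCPO.cyl_computable _ _), fun p q => ⟨fun h => ?_, fun h => ?_⟩⟩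
  · by_contra hpq
    obtain ⟨m, hm⟩ := UCPO.dup_reflect _ _ (UCPO.cyl_computable _ _) (UCPO.cyl_computable _ _) h
    obtain ⟨y, hy, h1, h2⟩ := UCPO.cyl_reflect R hR (ι p) (ι q) ((hR' p p).2 le_rfl)
      (fun h => hpq ((hR' p q).1 h)) m
    exact h2 (hm y hy h1)
  · exact UCPO.dup_mono _ _ _ (UCPO.cyl_computable _ _) (UCPO.cyl_computable _ _)
      (UCPO.cyl_mono R hR _ _ ((hR' p q).2 h))
end

section
/- Non-rigidity of the witness. There exists a nonrecursive limit computable set A ⊆ ℕ such that: (i) the bounded finite-one degree of A contains a family {B_q}_{q ∈ ℚ ∩ (1,2)} with B_q ≡_bfo A and B_p <₁ B_q whenever p < q, and a family {W_n}_{n ∈ ℕ} with W_n ≡_bfo A and ¬(W_n ≤₁ W_m) for n ≠ m; and (ii) A is not m-rigid: there is a total computable function f : ℕ → ℕ such that for all x, x ∈ A ↔ f(x) ∈ A, yet f(x) ≠ x for infinitely many x (so f is a computable m-autoreduction of A that is not eventually the identity). Indeed, with a_0 = 0, a_{k+1} = a_k + k!, I_k = [a_k, a_{k+1}), the set A is constant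 on each block I_k, and the function f sending each x ∈ I_k to a_k witnesses (ii). -/
namespace NRW

open Nat.Partrec (Code)
open Filter

/-! ### Generic blocks -/

/-- Left endpoint of the `k`-th block, block sizes `c`. -/
def start (c : ℕ → ℕ) (k : ℕ) : ℕ := ∑ m ∈ Finset.range k, c m

/-- Block index and offset of a number. -/
def loc (c : ℕ → ℕ) (x : ℕ) : ℕ × ℕ :=
  Nat.rec (0, 0) (fun _ p => if p.2 + 1 < c p.1 then (p.1, p.2 + 1) else (p.1 + 1, 0)) x

/-- The union of the blocks with index in `S`. -/
def BS (S : Set ℕ) (c : ℕ → ℕ) : Set ℕ := {x | (loc c x).1 ∈ S}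

lemma start_succ (c : ℕ → ℕ) (k : ℕ) : start c (k+1) = start c k + c k := by
  simp [start, Finset.sum_range_succ]

lemma start_mono (c : ℕ → ℕ) : Monotone (start c) :=
  monotone_nat_of_le_succ fun k => by rw [start_succ]; omega

lemma loc_succ (c : ℕ → ℕ) (x : ℕ) : loc c (x+1) =
    if (loc c x).2 + 1 < c (loc c x).1 then ((loc c x).1, (loc c x).2 + 1)
      else ((loc c x).1 + 1, 0) := rfl

lemma loc_spec {c : ℕ → ℕ} (hc : ∀ k, 1 ≤ c k) (x : ℕ) :
    (loc c x).2 < c (loc c x).1 ∧ start c (loc c x).1 + (loc c x).2 = x := by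
  induction x with
  | zero => exact ⟨hc 0, by simp [loc, start]⟩
  | succ x ih =>
    rw [loc_succ]
    split_ifs with h
    · exact ⟨h, by simp only; omega⟩
    · refine ⟨hc _, ?_⟩
      simp only [start_succ]
      omega

lemma loc_unique {c : ℕ → ℕ} (hc : ∀ k, 1 ≤ c k) {x k : ℕ}
    (h1 : start c k ≤ x) (h2 : x < start c (k+1)) : (loc c x).1 = k := by
  obtain ⟨h3, h4⟩ := loc_spec hc x
  have h5 := start_succ c (loc c x).1
  rcases lt_trichotomy (loc c x).1 k with h | h | h
  · have := start_mono c (Nat.succ_le_of_lt h)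
    simp only [Nat.succ_eq_add_one] at this
    omega
  · exact h
  · have := start_mono c (Nat.succ_le_of_lt h)
    simp only [Nat.succ_eq_add_one] at this
    omega

lemma loc_pos {c : ℕ → ℕ} (hc : ∀ k, 1 ≤ c k) {k r : ℕ} (hr : r < c k) :
    loc c (start c k + r) = (k, r) := by
  have h := loc_unique hc (x := start c k + r) (k := k) (by omega) (by rw [start_succ]; omega)
  have h' := (loc_spec hc (start c k + r)).2
  rw [h] at h'
  ext
  · exact h
  · simp only; omega

lemma lt_loc {c : ℕ → ℕ} (hc : ∀ k, 1 ≤ c k) {x k : ℕ} (h : start c (k+1) ≤ x) :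
    k < (loc c x).1 := by
  by_contra hh
  obtain ⟨h3, h4⟩ := loc_spec hc x
  have := start_mono c (show (loc c x).1 + 1 ≤ k + 1 by omega)
  rw [start_succ] at this
  omega

lemma start_comp {c : ℕ → ℕ} (hc : Computable c) : Computable (start c) := by
  have : Computable fun k : ℕ => (Nat.rec 0 (fun y IH => IH + c y) k : ℕ) :=
    Computable.nat_rec (h := fun (_ : ℕ) (p : ℕ × ℕ) => p.2 + c p.1)
      Computable.id (Computable.const 0)
      (Primrec.nat_add.to_comp.comp (Computable.snd.comp Computable.snd)
        (hc.comp (Computable.fst.comp Computable.snd))).to₂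
  refine this.of_eq fun k => ?_
  induction k with
  | zero => simp [start]
  | succ k ih => rw [start_succ, ← ih]

lemma loc_comp {c : ℕ → ℕ} (hc : Computable c) : Computable (loc c) := by
  unfold loc
  refine Computable.nat_rec (f := fun x : ℕ => x) (g := fun _ => ((0, 0) : ℕ × ℕ))
    (h := fun (_ : ℕ) (q : ℕ × (ℕ × ℕ)) =>
      if q.2.2 + 1 < c q.2.1 then (q.2.1, q.2.2 + 1) else (q.2.1 + 1, 0))
      Computable.id (Computable.const _) ?_
  have e1 : Computable fun q : ℕ × (ℕ × (ℕ × ℕ)) => q.2.2.1 :=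
    Computable.fst.comp (Computable.snd.comp Computable.snd)
  have e2 : Computable fun q : ℕ × (ℕ × (ℕ × ℕ)) => q.2.2.2 :=
    Computable.snd.comp (Computable.snd.comp Computable.snd)
  have hlt : Computable₂ fun a b : ℕ => decide (a < b) := Primrec.nat_lt.decide.to_comp
  have := Computable.cond (hlt.comp (Computable.succ.comp e2) (hc.comp e1))
    (e1.pair (Computable.succ.comp e2)) ((Computable.succ.comp e1).pair (Computable.const 0))
  refine Computable.of_eq this fun q => ?_
  simp only [Bool.cond_decide, Nat.succ_eq_add_one]

lemma pos_loc_comp {c d : ℕ → ℕ} (hc : Computable c) (hd : Computable d) {u : ℕ → ℕ}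
    (hu : Computable u) : Computable fun x => start d (loc c x).1 + u (loc c x).2 :=
  Primrec.nat_add.to_comp.comp ((start_comp hd).comp (Computable.fst.comp (loc_comp hc)))
    (hu.comp (Computable.snd.comp (loc_comp hc)))

lemma oneOne_of_le (S : Set ℕ) {c d : ℕ → ℕ} (hc : Computable c) (hd : Computable d)
    (h1 : ∀ k, 1 ≤ c k) (h : ∀ k, c k ≤ d k) : OneOneRed (BS S c) (BS S d) := by
  have h1d : ∀ k, 1 ≤ d k := fun k => (h1 k).trans (h k)
  have key : ∀ x, loc d (start d (loc c x).1 + (loc c x).2) = loc c x := fun x =>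
    loc_pos h1d ((loc_spec h1 x).1.trans_le (h _))
  refine ⟨_, pos_loc_comp hc hd Computable.id, ?_, ?_⟩
  · intro x y hxy
    have := congrArg (loc d) hxy
    simp only [id, key] at this
    rw [← (loc_spec h1 x).2, ← (loc_spec h1 y).2, this]
  · intro x
    simp only [BS, Set.mem_ofPred_eq, id, key]

lemma bfo_of_le (S : Set ℕ) {c d : ℕ → ℕ} (hc : Computable c) (hd : Computable d)
    (h1 : ∀ k, 1 ≤ c k) (h1d : ∀ k, 1 ≤ d k) (h : ∀ k, c k ≤ 2 * d k) :
    BfoRed (BS S c) (BS S d) := by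
  have key : ∀ x, loc d (start d (loc c x).1 + (loc c x).2 / 2)
      = ((loc c x).1, (loc c x).2 / 2) := fun x =>
    loc_pos h1d (by have := (loc_spec h1 x).1; have := h (loc c x).1; omega)
  have hdiv : Computable fun n : ℕ => n / 2 :=
    (Primrec.nat_div.comp Primrec.id (Primrec.const 2)).to_comp
  refine ⟨_, pos_loc_comp hc hd hdiv, ⟨2, by norm_num, ?_⟩, ?_⟩
  · intro y
    have hsub : {x | start d (loc c x).1 + (loc c x).2 / 2 = y} ⊆
        {start c (loc d y).1 + 2 * (loc d y).2, start c (loc d y).1 + (2 * (loc d y).2 + 1)} := by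
      intro x hx
      simp only [Set.mem_ofPred_eq] at hx
      have hk := key x
      rw [hx] at hk
      rw [hk]
      have := (loc_spec h1 x).2
      simp only [Set.mem_insert_iff, Set.mem_singleton_iff]
      omega
    exact (Set.encard_le_encard hsub).trans ((Set.encard_insert_le _ _).trans (by
      rw [Set.encard_singleton]; norm_num))
  · intro x
    simp only [BS, Set.mem_ofPred_eq, key]

/-! ### The sparse set `S` -/

/-- Stage `s` approximation to a dominating function. -/
def F (s n : ℕ) : ℕ :=
  Nat.rec (n + 1) (fun e acc => acc + (Code.evaln s (Code.ofNatCode e) n).getD 0) (n + 1)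

/-- Stage `s` approximation to the enumeration of `S`. -/
def K (s i : ℕ) : ℕ :=
  Nat.rec 0 (fun i k => Nat.pair i.unpair.1 (F s k)) i

lemma F_primrec : Primrec₂ F := by
  unfold F
  refine Primrec.nat_rec' (f := fun p : ℕ × ℕ => p.2 + 1) (g := fun p : ℕ × ℕ => p.2 + 1)
    (h := fun (p : ℕ × ℕ) (q : ℕ × ℕ) =>
      q.2 + (Code.evaln p.1 (Code.ofNatCode q.1) p.2).getD 0)
    (Primrec.succ.comp Primrec.snd) (Primrec.succ.comp Primrec.snd) ?_
  have e1 : Primrec fun z : (ℕ × ℕ) × (ℕ × ℕ) => ((z.1.1, Code.ofNatCode z.2.1), z.1.2) := by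
    refine Primrec.pair (Primrec.pair (Primrec.fst.comp Primrec.fst) ?_)
      (Primrec.snd.comp Primrec.fst)
    exact (Primrec.ofNat Code).comp (Primrec.fst.comp Primrec.snd)
  exact Primrec.nat_add.comp (Primrec.snd.comp Primrec.snd)
    (Primrec.option_getD.comp (Code.primrec_evaln.comp e1) (Primrec.const 0))

lemma K_primrec : Primrec₂ K := by
  unfold K
  refine Primrec.nat_rec' (f := fun p : ℕ × ℕ => p.2) (g := fun _ : ℕ × ℕ => 0)
    (h := fun (p : ℕ × ℕ) (q : ℕ × ℕ) => Nat.pair q.1.unpair.1 (F p.1 q.2))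
    Primrec.snd (Primrec.const 0) ?_
  exact Primrec₂.natPair.comp
    (Primrec.fst.comp (Primrec.unpair.comp (Primrec.fst.comp Primrec.snd)))
    (F_primrec.comp (Primrec.fst.comp Primrec.fst) (Primrec.snd.comp Primrec.snd))

lemma evaln_limit (c : Code) (n : ℕ) : ∃ y, ∀ᶠ s in atTop, Code.evaln s c n = y := by
  by_cases h : ∃ s y, Code.evaln s c n = some y
  · obtain ⟨s, y, h⟩ := h
    refine ⟨some y, eventually_atTop.2 ⟨s, fun t ht => ?_⟩⟩
    exact Code.evaln_mono ht h
  · push Not at h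
    exact ⟨none, Eventually.of_forall fun s => Option.eq_none_iff_forall_ne_some.2 (h s)⟩

lemma F_limit_aux (n m : ℕ) : ∃ y, n + 1 ≤ y ∧
    (∀ e < m, ∀ v ∈ Code.eval (Code.ofNatCode e) n, v + (n+1) ≤ y) ∧ ∀ᶠ s in atTop,
    (Nat.rec (n + 1) (fun e acc => acc + (Code.evaln s (Code.ofNatCode e) n).getD 0) m : ℕ)
      = y := by
  induction m with
  | zero => exact ⟨n+1, le_rfl, by simp, by simp⟩
  | succ m ih =>
    obtain ⟨y, hy1, hy2, hy3⟩ := ih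
    obtain ⟨z, hz⟩ := evaln_limit (Code.ofNatCode m) n
    refine ⟨y + z.getD 0, by omega, ?_, ?_⟩
    · intro e he v hv
      rcases Nat.lt_succ_iff_lt_or_eq.1 he with h | h
      · have := hy2 e h v hv; omega
      · subst h
        obtain ⟨s, hs⟩ := Code.evaln_complete.1 hv
        obtain ⟨t, ht⟩ := eventually_atTop.1 hz
        have h1 := ht (max s t) (le_max_right _ _)
        have h2 := Code.evaln_mono (le_max_left s t) hs
        rw [h1] at h2
        have h3 : z = some v := h2
        rw [h3]
        simp only [Option.getD_some]
        omega
    · filter_upwards [hy3, hz] with s h1 h2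
      simp only [h1, h2]

lemma F_limit : ∃ G : ℕ → ℕ, (∀ n, n < G n) ∧ (∀ n, ∀ᶠ s in atTop, F s n = G n) ∧
    ∀ H : ℕ → ℕ, Computable H → ∃ n₀, ∀ n ≥ n₀, H n < G n := by
  choose G h1 h2 h3 using fun n => F_limit_aux n (n+1)
  refine ⟨G, fun n => h1 n, h3, fun H hH => ?_⟩
  obtain ⟨c, hc⟩ := Code.exists_code.1 (Partrec.nat_iff.1 hH)
  refine ⟨Encodable.encode c, fun n hn => ?_⟩
  have hcc : Code.ofNatCode (Encodable.encode c) = c := Denumerable.ofNat_encode c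
  have := h2 n (Encodable.encode c) (by omega) (H n) (by rw [hcc, hc]; simp)
  omega

lemma exists_S : ∃ S : Set ℕ, (∃ g : ℕ → ℕ → Bool, Computable₂ g ∧
    ∀ n, ∃ s₀, ∀ s, s₀ ≤ s → (g s n = true ↔ n ∈ S)) ∧
    (∀ n, ∃ k ∈ S, n < k) ∧
    ∀ H : ℕ → ℕ, Computable H → ∀ t k₀, ∃ k ∈ S, k₀ ≤ k ∧ k.unpair.1 = t ∧
      ∀ j, k < j → j ≤ H k → j ∉ S := by
  obtain ⟨G, hG1, hG2, hG3⟩ := F_limit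
  let L : ℕ → ℕ := fun i => Nat.rec 0 (fun i k => Nat.pair i.unpair.1 (G k)) i
  have hLs : ∀ i, L (i+1) = Nat.pair i.unpair.1 (G (L i)) := fun i => rfl
  have hLG : ∀ i, G (L i) ≤ L (i+1) := fun i => by rw [hLs]; exact Nat.right_le_pair _ _
  have hLm : StrictMono L := strictMono_nat_of_lt_succ fun i => (hG1 _).trans_le (hLG i)
  have hLi : ∀ i, i ≤ L i := fun i => hLm.le_apply
  have hlim : ∀ i, ∀ᶠ s in atTop, K s i = L i := by
    intro i
    induction i with
    | zero => exact Eventually.of_forall fun s => rfl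
    | succ i ih =>
      filter_upwards [ih, hG2 (L i)] with s h1 h2
      rw [hLs, ← h2, ← h1]
      rfl
  refine ⟨Set.range L, ?_, ?_, ?_⟩
  · refine ⟨fun s n => decide (∃ i < n + 1, K s i = n), ?_, ?_⟩
    · have hR : PrimrecRel fun (i : ℕ) (p : ℕ × ℕ) => K p.1 i = p.2 :=
        Primrec.eq.comp
          (K_primrec.comp (Primrec.fst.comp Primrec.snd) Primrec.fst)
          (Primrec.snd.comp Primrec.snd)
      have := hR.exists_mem_list
      have h2 : PrimrecPred fun p : ℕ × ℕ => ∃ i < p.2 + 1, K p.1 i = p.2 :=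
        (this.comp (Primrec.list_range.comp (Primrec.succ.comp Primrec.snd)) Primrec.id).of_eq
          fun p => by simp
      exact h2.decide.to_comp
    · intro n
      have : ∀ᶠ s in atTop, ∀ i ∈ Finset.range (n+1), K s i = L i :=
        (Finset.eventually_all _).2 fun i _ => hlim i
      obtain ⟨s₀, hs⟩ := eventually_atTop.1 this
      refine ⟨s₀, fun s hss => ?_⟩
      have h := hs s hss
      simp only [decide_eq_true_eq]
      constructor
      · rintro ⟨i, hi, rfl⟩
        exact ⟨i, (h i (Finset.mem_range.2 hi)).symm⟩
      · rintro ⟨i, rfl⟩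
        have hi : i < L i + 1 := Nat.lt_succ_of_le (hLi i)
        exact ⟨i, hi, h i (Finset.mem_range.2 hi)⟩
  · intro n
    exact ⟨L (n+1), ⟨n+1, rfl⟩, hLi (n+1)⟩
  · intro H hH t k₀
    obtain ⟨n₀, hn⟩ := hG3 H hH
    let i := Nat.pair t (k₀ + n₀) + 1
    have hi : k₀ + n₀ ≤ i := (Nat.right_le_pair _ _).trans (Nat.le_succ _)
    refine ⟨L i, ⟨i, rfl⟩, by have := hLi i; omega, ?_, ?_⟩
    · simp [i, hLs]
    · rintro j h1 h2 ⟨m, rfl⟩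
      have h3 := hn (L i) (by have := hLi i; omega)
      have h4 := hLG i
      have h5 := (hLm.lt_iff_lt (a := i) (b := m)).1 h1
      have h6 := hLm.monotone (Nat.succ_le_of_lt h5)
      simp only [Nat.succ_eq_add_one] at h6
      omega

/-! ### The non-reduction lemma -/

lemma not_oneOne {S : Set ℕ}
    (hS : ∀ H : ℕ → ℕ, Computable H → ∀ t k₀, ∃ k ∈ S, k₀ ≤ k ∧ k.unpair.1 = t ∧
      ∀ j, k < j → j ≤ H k → j ∉ S)
    {c d : ℕ → ℕ} (hc : Computable c) (hd : Computable d)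
    (h1 : ∀ k, 1 ≤ c k) (h1d : ∀ k, 1 ≤ d k) (t k₀ : ℕ)
    (h : ∀ k ≥ k₀, k.unpair.1 = t → start d (k+1) < c k) :
    ¬ OneOneRed (BS S c) (BS S d) := by
  rintro ⟨f, hf, hinj, hred⟩
  let H : ℕ → ℕ := fun k =>
    Nat.rec 0 (fun r acc => acc + (loc d (f (start c k + r))).1) (c k)
  have hH : Computable H := by
    refine Computable.nat_rec (f := c) (g := fun _ => 0)
      (h := fun (k : ℕ) (p : ℕ × ℕ) => p.2 + (loc d (f (start c k + p.1))).1)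
      hc (Computable.const 0) ?_
    exact Primrec.nat_add.to_comp.comp (Computable.snd.comp Computable.snd)
      (Computable.fst.comp ((loc_comp hd).comp (hf.comp
        (Primrec.nat_add.to_comp.comp ((start_comp hc).comp Computable.fst)
          (Computable.fst.comp Computable.snd)))))
  have hHb : ∀ k r, r < c k → (loc d (f (start c k + r))).1 ≤ H k := by
    intro k r hr
    have : ∀ m, r < m → (loc d (f (start c k + r))).1 ≤
        (Nat.rec 0 (fun r acc => acc + (loc d (f (start c k + r))).1) m : ℕ) := by
      intro m hm
      induction m with
      | zero => omega
      | succ m ih =>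
        simp only
        rcases Nat.lt_succ_iff_lt_or_eq.1 hm with h | h
        · have := ih h; omega
        · subst h; omega
    exact this _ hr
  obtain ⟨k, hkS, hk0, hkt, hk⟩ := hS H hH t k₀
  have hlt := h k hk0 hkt
  obtain ⟨r, hr, hrr⟩ : ∃ r < c k, start d (k+1) ≤ f (start c k + r) := by
    by_contra hcon
    push Not at hcon
    have := Finset.card_le_card_of_injOn (s := Finset.range (c k))
      (t := Finset.range (start d (k+1))) (fun r => f (start c k + r))
      (fun r hr => by
        simp only [Finset.coe_range, Set.mem_Iio] at hr ⊢
        exact hcon r (by simpa using hr))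
      (fun a _ b _ hab => by have := hinj hab; omega)
    simp only [Finset.card_range] at this
    omega
  refine hk _ (lt_loc h1d hrr) (hHb k r hr) ?_
  have := (hred (start c k + r)).1 (by simp only [BS, Set.mem_ofPred_eq, loc_pos h1 hr]; exact hkS)
  exact this

/-! ### Arithmetic -/

lemma start_fact_le (k : ℕ) : start Nat.factorial (k+1) ≤ 2 * k.factorial := by
  induction k with
  | zero => simp [start]
  | succ k ih =>
    rw [start_succ]
    rcases Nat.eq_zero_or_pos k with h | h
    · subst h; simp [start]
    · rw [Nat.factorial_succ] at *
      nlinarith [Nat.factorial_pos k]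

lemma mul_start_fact_le (k : ℕ) : k * start Nat.factorial k ≤ 2 * k.factorial := by
  cases k with
  | zero => simp
  | succ k =>
    have := start_fact_le k
    rw [Nat.factorial_succ]
    nlinarith

lemma start_le_two {d : ℕ → ℕ} (h : ∀ k, d k ≤ 2 * k.factorial) (k : ℕ) :
    start d k ≤ 2 * start Nat.factorial k := by
  unfold start
  rw [Finset.mul_sum]
  exact Finset.sum_le_sum fun i _ => h i

lemma fact_comp : Computable Nat.factorial := by
  have : Computable fun k : ℕ => (Nat.rec 1 (fun y IH => (y+1) * IH) k : ℕ) :=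
    Computable.nat_rec (h := fun (_ : ℕ) (p : ℕ × ℕ) => (p.1 + 1) * p.2)
      Computable.id (Computable.const 1)
      (Primrec.nat_mul.to_comp.comp (Computable.succ.comp (Computable.fst.comp Computable.snd))
        (Computable.snd.comp Computable.snd)).to₂
  refine this.of_eq fun k => ?_
  induction k with
  | zero => simp
  | succ k ih => rw [Nat.factorial_succ, ← ih]

/-- Block sizes for the chain. -/
def cq (q : ℚ) (k : ℕ) : ℕ := q.num.toNat * k.factorial / q.den

lemma cq_comp (q : ℚ) : Computable (cq q) :=
  Primrec.nat_div.to_comp.comp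
    (Primrec.nat_mul.to_comp.comp (Computable.const _) fact_comp) (Computable.const _)

lemma cq_eq {q : ℚ} (hq : 0 < q) (k : ℕ) : cq q k = ⌊q * k.factorial⌋₊ := by
  have h : q * k.factorial = ((q.num.toNat * k.factorial : ℕ) : ℚ) / (q.den : ℚ) := by
    have h0 : ((q.num.toNat : ℤ)) = q.num := Int.toNat_of_nonneg (Rat.num_nonneg.2 hq.le)
    have h2 : ((q.num.toNat : ℕ) : ℚ) = (q.num : ℚ) := by exact_mod_cast congrArg (Int.cast (R := ℚ)) h0
    push_cast
    rw [h2]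
    conv_lhs => rw [← Rat.num_div_den q]
    ring
  rw [h, Nat.floor_div_eq_div, cq]

lemma cq_lower {q : ℚ} (hq : q ∈ Set.Ioo (1 : ℚ) 2) (k : ℕ) : k.factorial ≤ cq q k := by
  rw [cq_eq (by linarith [hq.1])]
  apply Nat.le_floor
  have : (0:ℚ) < k.factorial := by exact_mod_cast Nat.factorial_pos k
  nlinarith [hq.1]

lemma cq_upper {q : ℚ} (hq : q ∈ Set.Ioo (1 : ℚ) 2) (k : ℕ) : cq q k ≤ 2 * k.factorial := by
  rw [cq_eq (by linarith [hq.1])]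
  apply Nat.floor_le_of_le
  have : (0:ℚ) < k.factorial := by exact_mod_cast Nat.factorial_pos k
  push_cast
  nlinarith [hq.2]

lemma cq_mono {p q : ℚ} (hp : p ∈ Set.Ioo (1 : ℚ) 2) (hpq : p < q) (k : ℕ) :
    cq p k ≤ cq q k := by
  rw [cq_eq (by linarith [hp.1]), cq_eq (by linarith [hp.1])]
  apply Nat.floor_mono
  gcongr

lemma cq_gap {p q : ℚ} (hp : p ∈ Set.Ioo (1 : ℚ) 2)
    (hpq : p < q) : ∃ k₀, ∀ k ≥ k₀, start (cq p) (k+1) < cq q k := by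
  obtain ⟨k₀, hk⟩ := exists_nat_gt (6 / (q - p))
  refine ⟨k₀ + 1, fun k hkk => ?_⟩
  have hd : 0 < q - p := by linarith
  rw [div_lt_iff₀ hd] at hk
  have h1 := start_le_two (cq_upper hp) k
  have h2 := mul_start_fact_le k
  have h3 : 1 ≤ start Nat.factorial k := by
    have := start_mono Nat.factorial (show 1 ≤ k by omega)
    simpa [start] using this
  rw [start_succ]
  have hqf : q * k.factorial < cq q k + 1 := by
    rw [cq_eq (by linarith [hp.1])]; exact Nat.lt_floor_add_one _
  have hpf : (cq p k : ℚ) ≤ p * k.factorial := by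
    rw [cq_eq (by linarith [hp.1])]
    exact Nat.floor_le (by have := hp.1; positivity)
  have h1' : (start (cq p) k : ℚ) ≤ 2 * start Nat.factorial k := by exact_mod_cast h1
  have h2' : (k : ℚ) * start Nat.factorial k ≤ 2 * k.factorial := by exact_mod_cast h2
  have h3' : (1 : ℚ) ≤ start Nat.factorial k := by exact_mod_cast h3
  have hkq : (k₀ : ℚ) ≤ k := by exact_mod_cast (by omega : k₀ ≤ k)
  have h6 : 6 < k * (q - p) := hk.trans_le (by gcongr)
  have h7 : 3 * (start Nat.factorial k : ℚ) < (q - p) * k.factorial := by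
    have a1 : 6 * (start Nat.factorial k : ℚ) < (k * (q-p)) * start Nat.factorial k := by
      apply mul_lt_mul_of_pos_right h6; linarith
    have a2 := mul_le_mul_of_nonneg_left h2' hd.le
    nlinarith
  have : ((start (cq p) k + cq p k : ℕ) : ℚ) < cq q k := by push_cast; nlinarith
  exact_mod_cast this

/-- Block sizes for the antichain. -/
def cw (n k : ℕ) : ℕ := if k.unpair.1 = n then 2 * k.factorial else k.factorial

lemma cw_comp (n : ℕ) : Computable (cw n) := by
  have e : Computable fun k : ℕ => decide (k.unpair.1 = n) :=
    (PrimrecPred.decide (Primrec.eq.comp (Primrec.fst.comp Primrec.unpair)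
      (Primrec.const n))).to_comp
  refine (Computable.cond e (Primrec.nat_mul.to_comp.comp (Computable.const 2) fact_comp)
    fact_comp).of_eq fun k => ?_
  simp [cw, Bool.cond_decide]

lemma cw_lower (n k : ℕ) : k.factorial ≤ cw n k := by
  unfold cw; split_ifs <;> omega

lemma cw_upper (n k : ℕ) : cw n k ≤ 2 * k.factorial := by
  unfold cw; split_ifs <;> omega

lemma cw_gap {n m : ℕ} (hnm : n ≠ m) (k : ℕ) (hk : 5 ≤ k) (ht : k.unpair.1 = n) :
    start (cw m) (k+1) < cw n k := by
  rw [start_succ]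
  have h1 := start_le_two (cw_upper m) k
  have h2 := mul_start_fact_le k
  have h3 : cw n k = 2 * k.factorial := by simp [cw, ht]
  have h4 : cw m k = k.factorial := by simp [cw, ht, hnm]
  have := Nat.factorial_pos k
  nlinarith

lemma not_computable_S {S : Set ℕ} (hinf : ∀ n, ∃ k ∈ S, n < k)
    (hS : ∀ H : ℕ → ℕ, Computable H → ∀ t k₀, ∃ k ∈ S, k₀ ≤ k ∧ k.unpair.1 = t ∧
      ∀ j, k < j → j ≤ H k → j ∉ S) : ¬ ComputablePred (· ∈ S) := by
  rintro ⟨hdec, hcomp⟩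
  have hlt : Computable₂ fun a b : ℕ => decide (a < b) := Primrec.nat_lt.decide.to_comp
  have hp : Computable₂ fun (n k : ℕ) => decide (n < k) && decide (k ∈ S) :=
    Primrec.and.to_comp.comp hlt (hcomp.comp Computable.snd)
  have hr : Partrec fun n : ℕ =>
      Nat.rfind (PFun.lift fun k => decide (n < k) && decide (k ∈ S)) :=
    Partrec.rfind hp.partrec₂
  have hex : ∀ n, ∃ j, j ∈ Nat.rfind (PFun.lift fun k => decide (n < k) && decide (k ∈ S)) := by
    intro n
    obtain ⟨k, hk, hnk⟩ := hinf n
    obtain ⟨j, hj, _⟩ := Nat.rfind_min' (p := fun k => decide (n < k) && decide (k ∈ S)) (m := k)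
      (by simp [hk, hnk])
    exact ⟨j, hj⟩
  choose H hHm using hex
  have hH : Computable H := Partrec.of_eq hr fun n => Part.eq_some_iff.2 (hHm n)
  obtain ⟨k, _, _, _, hk⟩ := hS H hH 0 0
  have hsp := Nat.rfind_spec (hHm k)
  have hsp1 : true = (decide (k < H k) && decide (H k ∈ S)) := by
    obtain ⟨_, h⟩ := hsp
    exact h.symm
  have hsp' := (Bool.and_eq_true _ _).mp hsp1.symm
  simp only [decide_eq_true_eq] at hsp'
  exact hk (H k) hsp'.1 le_rfl hsp'.2

end NRW

/-- **Non-rigidity of the witness.**  There exists a nonrecursive limit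
computable set `A` such that: (i) the bounded finite-one degree of `A` contains
a family `{B_q}_{q ∈ ℚ ∩ (1,2)}` with `B_q ≡_bfo A` and `B_p <₁ B_q` whenever
`p < q`, and a family `{W_n}` with `W_n ≡_bfo A` and `¬ W_n ≤₁ W_m` for
`n ≠ m`; and (ii) `A` is not m-rigid: `A` is constant on each block
`I_k = [a_k, a_{k+1})`, and the total computable function `f` sending each
`x ∈ I_k` to `a_k` is an m-autoreduction of `A` with `f x ≠ x` for infinitely
many `x`. -/
theorem non_rigidity_of_witness :
    ∃ A : Set ℕ,
      ¬ ComputablePred (· ∈ A) ∧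
      LimitComputable A ∧
      -- (i) the internal structure
      (∃ B : ℚ → Set ℕ,
        (∀ q ∈ Set.Ioo (1 : ℚ) 2, BfoEquiv (B q) A) ∧
        (∀ p ∈ Set.Ioo (1 : ℚ) 2, ∀ q ∈ Set.Ioo (1 : ℚ) 2,
          p < q → OneOneLt (B p) (B q))) ∧
      (∃ W : ℕ → Set ℕ,
        (∀ n, BfoEquiv (W n) A) ∧
        (∀ n m, n ≠ m → ¬ OneOneRed (W n) (W m))) ∧
      -- A is constant on each block I_k
      (∀ k, ∀ x ∈ Set.Ico (blockStart k) (blockStart (k+1)),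
            ∀ y ∈ Set.Ico (blockStart k) (blockStart (k+1)), (x ∈ A ↔ y ∈ A)) ∧
      -- (ii) A is not m-rigid, witnessed by the block-collapse map
      (∃ f : ℕ → ℕ, Computable f ∧
        (∀ k, ∀ x ∈ Set.Ico (blockStart k) (blockStart (k+1)), f x = blockStart k) ∧
        (∀ x, x ∈ A ↔ f x ∈ A) ∧
        {x | f x ≠ x}.Infinite) := by
  
  obtain ⟨S, ⟨g, hg, hgl⟩, hinf, hS⟩ := NRW.exists_S
  have hf1 : ∀ k : ℕ, 1 ≤ k.factorial := Nat.factorial_pos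
  have hstart : ∀ k, blockStart k = NRW.start Nat.factorial k := fun k => rfl
  have hloc : ∀ k, ∀ x ∈ Set.Ico (blockStart k) (blockStart (k+1)),
      (NRW.loc Nat.factorial x).1 = k := fun k x hx => NRW.loc_unique hf1 hx.1 hx.2
  have hblk : Computable fun x => (NRW.loc Nat.factorial x).1 :=
    Computable.fst.comp (NRW.loc_comp NRW.fact_comp)
  have hlp : ∀ k, NRW.loc Nat.factorial (NRW.start Nat.factorial k) = (k, 0) := fun k => by
    simpa using NRW.loc_pos hf1 (k := k) (r := 0) (hf1 k)
  have hbfo : ∀ c : ℕ → ℕ, Computable c → (∀ k, k.factorial ≤ c k) →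
      (∀ k, c k ≤ 2 * k.factorial) →
      BfoEquiv (NRW.BS S c) (NRW.BS S Nat.factorial) := by
    intro c hc hl hu
    have h1 : ∀ k, 1 ≤ c k := fun k => (hf1 k).trans (hl k)
    exact ⟨NRW.bfo_of_le S hc NRW.fact_comp h1 hf1 hu,
      NRW.bfo_of_le S NRW.fact_comp hc hf1 h1 fun k => by have := hl k; omega⟩
  refine ⟨NRW.BS S Nat.factorial, ?_, ?_, ?_, ?_, ?_, ?_⟩
  · intro hA
    refine NRW.not_computable_S hinf hS ?_
    obtain ⟨hdec, hcomp⟩ := hA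
    have hiff : ∀ k, NRW.start Nat.factorial k ∈ NRW.BS S Nat.factorial ↔ k ∈ S := fun k => by
      simp [NRW.BS, hlp]
    refine ⟨fun k => decidable_of_iff _ (hiff k), ?_⟩
    refine Computable.of_eq (hcomp.comp (NRW.start_comp NRW.fact_comp)) fun k => ?_
    simp only [decide_eq_decide]
    exact hiff k
  · refine ⟨fun s x => g s (NRW.loc Nat.factorial x).1, ?_, ?_⟩
    · exact hg.comp Computable.fst (hblk.comp Computable.snd)
    · intro n
      exact hgl _
  · refine ⟨fun q => NRW.BS S (NRW.cq q), ?_, ?_⟩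
    · intro q hq
      exact hbfo _ (NRW.cq_comp q) (NRW.cq_lower hq) (NRW.cq_upper hq)
    · intro p hp q hq hpq
      have h1p : ∀ k, 1 ≤ NRW.cq p k := fun k => (hf1 k).trans (NRW.cq_lower hp k)
      have h1q : ∀ k, 1 ≤ NRW.cq q k := fun k => (hf1 k).trans (NRW.cq_lower hq k)
      obtain ⟨k₀, hk⟩ := NRW.cq_gap hp hpq
      exact ⟨NRW.oneOne_of_le S (NRW.cq_comp p) (NRW.cq_comp q) h1p (NRW.cq_mono hp hpq),
        NRW.not_oneOne hS (NRW.cq_comp q) (NRW.cq_comp p) h1q h1p 0 k₀ fun k h _ => hk k h⟩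
  · refine ⟨fun n => NRW.BS S (NRW.cw n), ?_, ?_⟩
    · intro n
      exact hbfo _ (NRW.cw_comp n) (NRW.cw_lower n) (NRW.cw_upper n)
    · intro n m hnm
      exact NRW.not_oneOne hS (NRW.cw_comp n) (NRW.cw_comp m)
        (fun k => (hf1 k).trans (NRW.cw_lower n k)) (fun k => (hf1 k).trans (NRW.cw_lower m k))
        n 5 fun k h ht => NRW.cw_gap hnm k h ht
  · intro k x hx y hy
    simp only [NRW.BS, Set.mem_ofPred_eq, hloc k x hx, hloc k y hy]
  · refine ⟨fun x => NRW.start Nat.factorial (NRW.loc Nat.factorial x).1,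
      (NRW.start_comp NRW.fact_comp).comp hblk, ?_, ?_, ?_⟩
    · intro k x hx
      simp only [hloc k x hx, hstart]
    · intro x
      simp only [NRW.BS, Set.mem_ofPred_eq, hlp]
    · refine Set.infinite_of_not_bddAbove ?_
      rintro ⟨b, hb⟩
      have h2 : 1 < (b + 2).factorial := Nat.one_lt_factorial.2 (by omega)
      have hl := NRW.loc_pos hf1 h2
      have hmem := hb (a := NRW.start Nat.factorial (b+2) + 1) (by
        simp only [Set.mem_ofPred_eq, hl]; omega)
      have hge : b + 2 ≤ NRW.start Nat.factorial (b+2) := by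
        have : ∀ k, k ≤ NRW.start Nat.factorial k := by
          intro k
          induction k with
          | zero => omega
          | succ k ih => rw [NRW.start_succ]; have := hf1 k; omega
        exact this _
      omega
end
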